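/- arXiv:1105.4562 — 7 statements merged into one kernel-verified Lean document; each statement's English description precedes it below -/
import Mathlib

section
/- For every M > 0 there is a constant C > 0 such that for all x, y ∈ ℝ with |x-y| ≤ M · min{1, 1/|x|} (where min{1, 1/|x|} is interpreted as 1 when x = 0), one has ∫_{m(x)}^∞ e^{-t} · |e^{-t}x - y| · |x - e^{-t}y| · (1-e^{-2t})^{-5/2} · exp(-(e^{-t}x - y)²/(1-e^{-2t})) dt ≤ C · max{1, |x|}, where m(x) = min{1, 1/x²} (interpreted as 1 when x = 0). -/
open MeasureTheory Set

/-- `m(x) = min{1, 1/x²}`, interpreted as `1` when `x = 0`. -/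
noncomputable def mfun (x : ℝ) : ℝ := if x = 0 then 1 else min 1 (1/x^2)

theorem ite_min_one_inv_abs_eq (x : ℝ) :
    (if x = 0 then 1 else min 1 (1 / |x|)) = 1 / max 1 |x| := by
  split_ifs with h
  · simp [h]
  · have hx : 0 < |x| := abs_pos.mpr h
    rcases le_total 1 |x| with h1 | h1
    · rw [max_eq_right h1, min_eq_right ((div_le_one hx).mpr h1)]
    · rw [max_eq_left h1, min_eq_left ((one_le_div hx).mpr h1), div_one]

theorem mfun_eq (x : ℝ) : mfun x = 1 / (max 1 |x|) ^ 2 := by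
  unfold mfun
  split_ifs with h
  · simp [h]
  · have hx : 0 < |x| := abs_pos.mpr h
    rw [← sq_abs x]
    rcases le_total 1 |x| with h1 | h1
    · rw [max_eq_right h1, min_eq_right ((div_le_one (by positivity)).mpr (one_le_pow₀ h1))]
    · rw [max_eq_left h1, min_eq_left ((one_le_div (by positivity)).mpr
        (pow_le_one₀ hx.le h1)), one_pow, div_one]

theorem div_one_add_le_one_sub_exp_neg {t : ℝ} (ht : 0 ≤ t) :
    t / (1 + t) ≤ 1 - Real.exp (-t) := by
  have h : Real.exp (-t) ≤ 1 / (1 + t) := by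
    rw [Real.exp_neg, ← one_div]
    exact one_div_le_one_div_of_le (by positivity) (by linarith [Real.add_one_le_exp t])
  have h2 : t / (1 + t) = 1 - 1 / (1 + t) := by field_simp; ring
  linarith

theorem one_add_pow_le_exp {v : ℝ} (hv : 0 ≤ v) {n k : ℕ} (hk : 1 ≤ k) :
    (1 + v) ^ n ≤ (k : ℝ) ^ n * Real.exp (n * (v / k)) := by
  have hk' : (1 : ℝ) ≤ k := by exact_mod_cast hk
  rw [Real.exp_nat_mul, ← mul_pow]
  gcongr
  have h := mul_le_mul_of_nonneg_left (Real.add_one_le_exp (v / k)) (zero_le_one.trans hk')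
  have h2 : (k : ℝ) * (v / k + 1) = v + k := by field_simp
  linarith

theorem exp_neg_mul_one_sub_exp_neg_rpow_le {t : ℝ} (ht : 0 < t) :
    Real.exp (-t) * (1 - Real.exp (-t)) ^ (-(5 : ℝ) / 2) ≤ 27 * t ^ (-(5 : ℝ) / 2) := by
  have hu := div_one_add_le_one_sub_exp_neg ht.le
  have h1 : (1 - Real.exp (-t)) ^ (-(5 : ℝ) / 2) ≤ t ^ (-(5 : ℝ) / 2) * (1 + t) ^ 3 := by
    calc (1 - Real.exp (-t)) ^ (-(5 : ℝ) / 2) ≤ (t / (1 + t)) ^ (-(5 : ℝ) / 2) :=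
          Real.rpow_le_rpow_of_nonpos (by positivity) hu (by norm_num)
      _ = t ^ (-(5 : ℝ) / 2) * (1 + t) ^ ((5 : ℝ) / 2) := by
          rw [Real.div_rpow ht.le (by positivity), neg_div,
            Real.rpow_neg (x := 1 + t) (by positivity), div_inv_eq_mul]
      _ ≤ t ^ (-(5 : ℝ) / 2) * (1 + t) ^ 3 := by
          gcongr
          rw [← Real.rpow_natCast]
          exact Real.rpow_le_rpow_of_exponent_le (by linarith) (by norm_num)
  have h2 : (1 + t) ^ 3 ≤ 27 * Real.exp t := by
    have := one_add_pow_le_exp ht.le (n := 3) (k := 3) (by norm_num)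
    have h3 : ((3 : ℕ) : ℝ) * (t / (3 : ℕ)) = t := by push_cast; ring
    rw [h3] at this
    norm_num at this
    exact this
  calc Real.exp (-t) * (1 - Real.exp (-t)) ^ (-(5 : ℝ) / 2)
      ≤ Real.exp (-t) * (t ^ (-(5 : ℝ) / 2) * (27 * Real.exp t)) := by
        gcongr
        exact h1.trans (by gcongr)
    _ = 27 * t ^ (-(5 : ℝ) / 2) * (Real.exp (-t) * Real.exp t) := by ring
    _ = 27 * t ^ (-(5 : ℝ) / 2) := by rw [← Real.exp_add]; simp

/-- Bound for the product of the two linear factors and the Gaussian, with `1 - r ^ 2` in the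
denominator and `X` in the role of `max 1 |x|`. -/
theorem cross_term_mul_gaussian_le {M X x y r : ℝ} (hM : 0 < M) (hX : 1 ≤ X) (hxX : |x| ≤ X)
    (hXx : X ^ 2 ≤ x ^ 2 + 1) (hxy : |x - y| ≤ M / X) (hr : 0 < r) (hr1 : r < 1)
    (hu : 1 / (2 * X ^ 2) ≤ 1 - r) :
    |r * x - y| * |x - r * y| * Real.exp (-(r * x - y) ^ 2 / (1 - r ^ 2)) ≤
      64 * (2 * M + 1) ^ 2 * Real.exp (2 * M ^ 2 + 1 / 4) / X ^ 2 := by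
  have hX0 : 0 < X := by linarith
  obtain ⟨u, rfl⟩ : ∃ u, r = 1 - u := ⟨1 - r, by ring⟩
  have hu0 : 0 < u := by linarith
  have hu1 : u < 1 := by linarith
  have hu' : 1 / (2 * X ^ 2) ≤ u := by linarith
  set v := u * X ^ 2 with hv
  have hv0 : 0 ≤ v := by positivity
  have hs : 0 < 1 - (1 - u) ^ 2 := by nlinarith
  have hMX : 0 < M / X := by positivity
  have huX : (1 + v) / X = 1 / X + u * X := by rw [hv]; field_simp
  have hy : |y| ≤ X + M / X := by
    have : |y| ≤ |x| + |x - y| := by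
      have := abs_sub x (x - y)
      simpa using this
    linarith
  have hK : M / X + (M / X + u * X) ≤ (2 * M + 1) * ((1 + v) / X) := by
    rw [huX]
    have h1 : M / X = M * (1 / X) := by ring
    have h2 : 0 < 1 / X := by positivity
    have h3 : 0 < M * (u * X) := by positivity
    rw [h1]
    nlinarith
  have ha : |(1 - u) * x - y| ≤ (2 * M + 1) * ((1 + v) / X) := by
    have h1 : (1 - u) * x - y = (x - y) - u * x := by ring
    have h2 : |(x - y) - u * x| ≤ |x - y| + u * |x| := by
      have := abs_sub (x - y) (u * x)
      rwa [abs_mul, abs_of_pos hu0] at this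
    rw [h1]
    have : u * |x| ≤ u * X := by gcongr
    linarith
  have hb : |x - (1 - u) * y| ≤ (2 * M + 1) * ((1 + v) / X) := by
    have h1 : x - (1 - u) * y = (x - y) + u * y := by ring
    have h2 : |(x - y) + u * y| ≤ |x - y| + u * |y| := by
      have := abs_add_le (x - y) (u * y)
      rwa [abs_mul, abs_of_pos hu0] at this
    rw [h1]
    have h3 : u * |y| ≤ u * (X + M / X) := by gcongr
    have h4 : u * (M / X) ≤ M / X := by nlinarith
    linarith
  have he : -((1 - u) * x - y) ^ 2 / (1 - (1 - u) ^ 2) ≤ (2 * M ^ 2 + 1 / 4) - v / 4 := by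
    rw [div_le_iff₀ hs]
    have hd : (x - y) ^ 2 ≤ 2 * M ^ 2 * u := by
      calc (x - y) ^ 2 = |x - y| ^ 2 := (sq_abs _).symm
        _ ≤ (M / X) ^ 2 := by gcongr
        _ = 2 * M ^ 2 * (1 / (2 * X ^ 2)) := by field_simp
        _ ≤ 2 * M ^ 2 * u := by gcongr
    have h1 : u ^ 2 * x ^ 2 / 2 - (x - y) ^ 2 ≤ ((1 - u) * x - y) ^ 2 := by
      nlinarith [sq_nonneg (2 * (x - y) - u * x)]
    have h2 : u ≤ 1 - (1 - u) ^ 2 := by nlinarith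
    have h3 : 2 * M ^ 2 * u ≤ 2 * M ^ 2 * (1 - (1 - u) ^ 2) := by gcongr
    have h4 : u * x ^ 2 / 4 * (1 - (1 - u) ^ 2) ≤ u * x ^ 2 / 4 * (2 * u) := by
      gcongr
      nlinarith
    have h5 : v - u ≤ u * x ^ 2 := by rw [hv]; nlinarith
    have h6 : (v / 4 - 1 / 4) * (1 - (1 - u) ^ 2) ≤ u * x ^ 2 / 4 * (1 - (1 - u) ^ 2) := by
      gcongr
      linarith
    linarith
  have hp : (1 + v) ^ 2 ≤ 64 * Real.exp (v / 4) := by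
    have := one_add_pow_le_exp hv0 (n := 2) (k := 8) (by norm_num)
    have h3 : ((2 : ℕ) : ℝ) * (v / (8 : ℕ)) = v / 4 := by push_cast; ring
    rw [h3] at this
    norm_num at this
    exact this
  calc _ ≤ (2 * M + 1) * ((1 + v) / X) * ((2 * M + 1) * ((1 + v) / X)) *
        Real.exp ((2 * M ^ 2 + 1 / 4) - v / 4) := by gcongr
    _ = (2 * M + 1) ^ 2 * (1 + v) ^ 2 / X ^ 2 * Real.exp ((2 * M ^ 2 + 1 / 4) - v / 4) := by
        ring
    _ ≤ (2 * M + 1) ^ 2 * (64 * Real.exp (v / 4)) / X ^ 2 *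
        Real.exp ((2 * M ^ 2 + 1 / 4) - v / 4) := by gcongr
    _ = 64 * (2 * M + 1) ^ 2 *
        (Real.exp ((2 * M ^ 2 + 1 / 4) - v / 4) * Real.exp (v / 4)) / X ^ 2 := by ring
    _ = _ := by rw [← Real.exp_add, sub_add_cancel]

theorem integral_Ioi_one_div_sq_rpow {X : ℝ} (hX : 0 < X) :
    ∫ t in Ioi (1 / X ^ 2), t ^ (-(5 : ℝ) / 2) = 2 / 3 * X ^ 3 := by
  rw [integral_Ioi_rpow_of_lt (by norm_num) (by positivity)]
  have h : (1 / X ^ 2) ^ (-(5 : ℝ) / 2 + 1) = X ^ 3 := by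
    rw [one_div, ← Real.rpow_natCast, ← Real.rpow_neg hX.le, ← Real.rpow_mul hX.le,
      ← Real.rpow_natCast]
    norm_num
  rw [h]
  ring

theorem ou_global_cross_term_estimate :
    ∀ M > (0:ℝ), ∃ C > (0:ℝ), ∀ x y : ℝ,
      |x - y| ≤ M * (if x = 0 then 1 else min 1 (1/|x|)) →
      (∫ t in Set.Ioi (mfun x),
        Real.exp (-t) * |Real.exp (-t) * x - y| * |x - Real.exp (-t) * y| *
          (1 - Real.exp (-2*t)) ^ (-(5:ℝ)/2) *
          Real.exp (-(Real.exp (-t) * x - y)^2 / (1 - Real.exp (-2*t)))) ≤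
        C * max 1 |x| := by
  intro M hM
  set A := 64 * (2 * M + 1) ^ 2 * Real.exp (2 * M ^ 2 + 1 / 4) with hA
  have hA0 : 0 < A := by positivity
  refine ⟨18 * A, by positivity, fun x y hxy => ?_⟩
  rw [ite_min_one_inv_abs_eq, mul_one_div] at hxy
  rw [mfun_eq]
  set X := max 1 |x| with hXdef
  have hX : 1 ≤ X := le_max_left _ _
  have hX0 : 0 < X := by linarith
  have hXx : X ^ 2 ≤ x ^ 2 + 1 := by
    rw [← sq_abs x]
    rcases max_choice 1 |x| with h | h <;> rw [hXdef, h] <;> nlinarith [sq_nonneg |x|]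
  have hm0 : 0 < 1 / X ^ 2 := by positivity
  have hm1 : 1 / X ^ 2 ≤ 1 := (div_le_one (by positivity)).mpr (one_le_pow₀ hX)
  have hbound : ∀ t ∈ Ioi (1 / X ^ 2),
      Real.exp (-t) * |Real.exp (-t) * x - y| * |x - Real.exp (-t) * y| *
          (1 - Real.exp (-2*t)) ^ (-(5:ℝ)/2) *
          Real.exp (-(Real.exp (-t) * x - y)^2 / (1 - Real.exp (-2*t))) ≤
        27 * A / X ^ 2 * t ^ (-(5 : ℝ) / 2) := by
    intro t ht
    have ht' : 1 / X ^ 2 < t := ht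
    have ht0 : 0 < t := hm0.trans ht'
    have hsq : Real.exp (-2 * t) = Real.exp (-t) ^ 2 := by
      rw [← Real.exp_nat_mul]; congr 1; push_cast; ring
    have hr1 : Real.exp (-t) < 1 := (Real.exp_lt_exp.mpr (by linarith)).trans_eq Real.exp_zero
    have hr0 := Real.exp_pos (-t)
    have hu : 1 / (2 * X ^ 2) ≤ 1 - Real.exp (-t) := by
      refine le_trans ?_ (div_one_add_le_one_sub_exp_neg ht0.le)
      have h1 : 1 / (2 * X ^ 2) = 1 / X ^ 2 / 2 := by field_simp
      rw [h1, le_div_iff₀ (by positivity)]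
      nlinarith
    have key := cross_term_mul_gaussian_le hM hX (le_max_right _ _) hXx hxy hr0 hr1 hu
    have hrad := exp_neg_mul_one_sub_exp_neg_rpow_le ht0
    rw [hsq]
    set r := Real.exp (-t)
    have hs : (1 - r ^ 2) ^ (-(5 : ℝ) / 2) ≤ (1 - r) ^ (-(5 : ℝ) / 2) :=
      Real.rpow_le_rpow_of_nonpos (by linarith) (by nlinarith) (by norm_num)
    have hs0 : 0 ≤ (1 - r ^ 2) ^ (-(5 : ℝ) / 2) := Real.rpow_nonneg (by nlinarith) _
    calc _ = r * (1 - r ^ 2) ^ (-(5 : ℝ) / 2) *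
          (|r * x - y| * |x - r * y| * Real.exp (-(r * x - y) ^ 2 / (1 - r ^ 2))) := by ring
      _ ≤ 27 * t ^ (-(5 : ℝ) / 2) * (A / X ^ 2) := by
          exact mul_le_mul ((mul_le_mul_of_nonneg_left hs hr0.le).trans hrad) key
            (by positivity) (by positivity)
      _ = _ := by ring
  have hint : IntegrableOn (fun t : ℝ => t ^ (-(5 : ℝ) / 2)) (Ioi (1 / X ^ 2)) :=
    integrableOn_Ioi_rpow_of_lt (by norm_num) hm0
  refine (integral_mono_of_nonneg ?_ (hint.const_mul (27 * A / X ^ 2))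
    ((ae_restrict_iff' measurableSet_Ioi).mpr (ae_of_all _ hbound))).trans_eq ?_
  · refine (ae_restrict_iff' measurableSet_Ioi).mpr (ae_of_all _ fun t ht => ?_)
    have ht0 : 0 < t := hm0.trans ht
    have : Real.exp (-2 * t) < 1 := (Real.exp_lt_exp.mpr (by linarith)).trans_eq Real.exp_zero
    have hs0 : 0 ≤ (1 - Real.exp (-2 * t)) ^ (-(5 : ℝ) / 2) :=
      Real.rpow_nonneg (by linarith) _
    simp only [Pi.zero_apply]
    positivity
  · rw [integral_const_mul, integral_Ioi_one_div_sq_rpow hX0]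
    field_simp
    ring
end

section
/- There is a constant C > 0 such that for all x, y ∈ ℝ, ∫_{m(x)}^∞ e^{-2t} · (1-e^{-2t})^{-3/2} · exp(-(e^{-t}x - y)²/(1-e^{-2t})) dt ≤ C · max{1, |x|}, where m(x) = min{1, 1/x²} (interpreted as 1 when x = 0). -/
open MeasureTheory Set

theorem mfun_eq_inv_sq (x : ℝ) : mfun x = ((max 1 |x|) ^ 2)⁻¹ := by
  unfold mfun
  split_ifs with h
  · simp [h]
  · have hx : 0 < x ^ 2 := by positivity
    rcases le_total 1 |x| with h1 | h1
    · have : 1 ≤ x ^ 2 := (one_le_sq_iff_one_le_abs x).2 h1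
      rw [max_eq_right h1, sq_abs, min_eq_right, one_div]
      exact (div_le_one hx).2 this
    · have : x ^ 2 ≤ 1 := (sq_le_one_iff_abs_le_one x).2 h1
      rw [max_eq_left h1, min_eq_left]
      · simp
      · exact (one_le_div hx).2 this

theorem one_sub_exp_neg_two_mul_pos {t : ℝ} (ht : 0 < t) : 0 < 1 - Real.exp (-2 * t) := by
  have : Real.exp (-2 * t) < 1 := Real.exp_lt_one_iff.2 (by linarith)
  linarith

theorem hasDerivAt_neg_one_sub_exp_rpow {t : ℝ} (ht : 0 < t) :
    HasDerivAt (fun t : ℝ => -(1 - Real.exp (-2 * t)) ^ (-(1:ℝ) / 2))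
      (Real.exp (-2 * t) * (1 - Real.exp (-2 * t)) ^ (-(3:ℝ) / 2)) t := by
  have h1 : HasDerivAt (fun t : ℝ => 1 - Real.exp (-2 * t)) (-(Real.exp (-2 * t) * (-2 * 1))) t :=
    (((hasDerivAt_id' t).const_mul (-2)).exp).const_sub 1
  have h2 := (h1.rpow_const (p := -(1:ℝ) / 2)
    (Or.inl (one_sub_exp_neg_two_mul_pos ht).ne')).neg
  refine h2.congr_deriv ?_
  rw [show -(1:ℝ) / 2 - 1 = -3 / 2 by norm_num]
  ring

theorem tendsto_neg_one_sub_exp_rpow :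
    Filter.Tendsto (fun t : ℝ => -(1 - Real.exp (-2 * t)) ^ (-(1:ℝ) / 2)) Filter.atTop
      (nhds (-1)) := by
  have h1 : Filter.Tendsto (fun t : ℝ => Real.exp (-2 * t)) Filter.atTop (nhds 0) :=
    Real.tendsto_exp_atBot.comp (Filter.tendsto_id.const_mul_atTop_of_neg (by norm_num))
  have h2 : Filter.Tendsto (fun t : ℝ => 1 - Real.exp (-2 * t)) Filter.atTop (nhds 1) := by
    simpa using h1.const_sub 1
  simpa using (h2.rpow_const (p := -(1:ℝ) / 2) (Or.inl one_ne_zero)).neg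

theorem one_sub_exp_rpow_le {M : ℝ} (hM : 1 ≤ M) :
    (1 - Real.exp (-2 * (M ^ 2)⁻¹)) ^ (-(1:ℝ) / 2) ≤ 2 * M := by
  have hM0 : 0 < M := by linarith
  have hm0 : 0 < (M ^ 2)⁻¹ := by positivity
  have hm1 : (M ^ 2)⁻¹ ≤ 1 := inv_le_one_of_one_le₀ (one_le_pow₀ hM)
  have hlow : ((2 * M) ^ 2)⁻¹ ≤ 1 - Real.exp (-2 * (M ^ 2)⁻¹) := by
    rw [mul_pow, mul_inv]
    generalize (M ^ 2)⁻¹ = m at *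
    have hexp : Real.exp (-2 * m) * Real.exp (2 * m) = 1 := by
      rw [← Real.exp_add]; simp
    have h1 := Real.add_one_le_exp (2 * m)
    have h2 := Real.exp_pos (-2 * m)
    nlinarith
  calc (1 - Real.exp (-2 * (M ^ 2)⁻¹)) ^ (-(1:ℝ) / 2)
      ≤ (((2 * M) ^ 2)⁻¹) ^ (-(1:ℝ) / 2) :=
        Real.rpow_le_rpow_of_nonpos (by positivity) hlow (by norm_num)
    _ = 2 * M := by
        rw [neg_div, Real.rpow_neg (by positivity), Real.inv_rpow (by positivity), inv_inv,
          ← Real.sqrt_eq_rpow, Real.sqrt_sq (by positivity)]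

theorem ou_global_gaussian_term_estimate :
    ∃ C > (0:ℝ), ∀ x y : ℝ,
      (∫ t in Set.Ioi (mfun x),
        Real.exp (-2*t) * (1 - Real.exp (-2*t)) ^ (-(3:ℝ)/2) *
          Real.exp (-(Real.exp (-t) * x - y)^2 / (1 - Real.exp (-2*t)))) ≤
        C * max 1 |x| := by
  refine ⟨2, two_pos, fun x y => ?_⟩
  have hM : 1 ≤ max 1 |x| := le_max_left _ _
  rw [mfun_eq_inv_sq]
  generalize max 1 |x| = M at *
  have hm : 0 < (M ^ 2)⁻¹ := by positivity
  have hpos : ∀ t ∈ Ioi (M ^ 2)⁻¹, 0 < 1 - Real.exp (-2 * t) :=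
    fun t ht => one_sub_exp_neg_two_mul_pos (hm.trans ht)
  have hderiv : ∀ t ∈ Ici (M ^ 2)⁻¹, HasDerivAt _ _ t :=
    fun t ht => hasDerivAt_neg_one_sub_exp_rpow (hm.trans_le ht)
  have hnonneg : ∀ t ∈ Ioi (M ^ 2)⁻¹,
      0 ≤ Real.exp (-2 * t) * (1 - Real.exp (-2 * t)) ^ (-(3:ℝ) / 2) := fun t ht =>
    mul_nonneg (Real.exp_pos _).le (Real.rpow_nonneg (hpos t ht).le _)
  have hint := integrableOn_Ioi_deriv_of_nonneg' hderiv hnonneg tendsto_neg_one_sub_exp_rpow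
  have heq := integral_Ioi_of_hasDerivAt_of_nonneg' hderiv hnonneg tendsto_neg_one_sub_exp_rpow
  refine (integral_mono_of_nonneg ?_ hint ?_).trans ?_
  · filter_upwards [ae_restrict_mem measurableSet_Ioi] with t ht
    exact mul_nonneg (hnonneg t ht) (Real.exp_pos _).le
  · filter_upwards [ae_restrict_mem measurableSet_Ioi] with t ht
    refine mul_le_of_le_one_right (hnonneg t ht) (Real.exp_le_one_iff.2 ?_)
    exact div_nonpos_of_nonpos_of_nonneg (neg_nonpos.2 (sq_nonneg _)) (hpos t ht).le
  · rw [heq]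
    linarith [one_sub_exp_rpow_le hM]
end

section
/- There is a constant C > 0 such that for all (x,y) ∈ N₂, ∫_0^{m(x)} | e^{-5t/2} · (1-e^{-2t})^{-3/2} · exp(-(e^{-t}x - y)²/(1-e^{-2t})) - (2t)^{-3/2} · exp(-(x-y)²/(2t)) | dt ≤ C · max{1, |x|}, where m(x) = min{1, 1/x²} (interpreted as 1 when x = 0). -/
open MeasureTheory Set

/-- The local region `N_s = { (x,y) : |x-y| ≤ s/(1+|x|+|y|) }`. -/
def Nreg (s : ℝ) : Set (ℝ × ℝ) :=
  {p : ℝ × ℝ | |p.1 - p.2| ≤ s / (1 + |p.1| + |p.2|)}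

/-- The `-3/2` power of a positive real as the cube of the inverse square root. -/
lemma rpow_neg_three_half {p : ℝ} (hp : 0 < p) : p ^ (-(3:ℝ)/2) = ((√p)⁻¹) ^ 3 := by
  rw [Real.sqrt_eq_rpow, ← Real.rpow_neg hp.le, ← Real.rpow_natCast, ← Real.rpow_mul hp.le]
  norm_num

/-- Perturbation bound for two weighted Gaussian factors `p e^{-g}` and `q e^{-h}`. -/
lemma abs_mul_exp_sub_mul_exp_le {p q g h D : ℝ} (hp : 0 ≤ p) (hh : 0 ≤ h)
    (hD : |g - h| ≤ D) :
    |p * Real.exp (-g) - q * Real.exp (-h)| ≤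
      |p - q| + p * Real.exp D * (|g - h| * Real.exp (-h)) := by
  have hexp : |Real.exp (-(g - h)) - 1| ≤ |g - h| * Real.exp D := by
    have h1 := Real.add_one_le_exp (-(g - h))
    have h2 := Real.add_one_le_exp (g - h)
    have h3 : Real.exp (-(g - h)) * Real.exp (g - h) = 1 := by
      rw [← Real.exp_add]; simp
    have h4 : Real.exp (-(g - h)) ≤ Real.exp D :=
      Real.exp_le_exp.2 ((neg_le_abs _).trans hD)
    have h5 : 1 ≤ Real.exp D := Real.one_le_exp ((abs_nonneg _).trans hD)
    have h6 := le_abs_self (g - h)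
    have h7 := neg_le_abs (g - h)
    have h8 : |g - h| * Real.exp (-(g - h)) ≤ |g - h| * Real.exp D := by gcongr
    have h9 : |g - h| * 1 ≤ |g - h| * Real.exp D := by gcongr
    have h10 := Real.exp_pos (-(g - h))
    rw [abs_le]
    constructor <;> nlinarith
  have hsplit : p * Real.exp (-g) - q * Real.exp (-h) =
      (p - q) * Real.exp (-h) + p * ((Real.exp (-(g - h)) - 1) * Real.exp (-h)) := by
    have : Real.exp (-g) = Real.exp (-(g - h)) * Real.exp (-h) := by
      rw [← Real.exp_add]; congr 1; ring
    rw [this]; ring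
  have hle : Real.exp (-h) ≤ 1 := Real.exp_le_one_iff.2 (by linarith)
  rw [hsplit]
  refine (abs_add_le _ _).trans (add_le_add ?_ ?_)
  · rw [abs_mul, abs_of_pos (Real.exp_pos _)]
    exact mul_le_of_le_one_right (abs_nonneg _) hle
  · rw [abs_mul, abs_mul, abs_of_nonneg hp, abs_of_pos (Real.exp_pos (-h)), mul_assoc]
    refine mul_le_mul_of_nonneg_left ?_ hp
    nlinarith [Real.exp_pos (-h)]

/-- Comparison of the square roots of `1 / (2t)` and `1 / (1 - e^{-2t})` for `0 < t ≤ 1`. -/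
lemma inv_sqrt_comparison {t : ℝ} (ht : 0 < t) (ht1 : t ≤ 1) :
    0 < 1 - Real.exp (-2*t) ∧ (√(2*t))⁻¹ ≤ (√(1 - Real.exp (-2*t)))⁻¹ ∧
      ((√(1 - Real.exp (-2*t)))⁻¹) ^ 2 ≤ ((√(2*t))⁻¹) ^ 2 + 1 ∧
      (√(1 - Real.exp (-2*t)))⁻¹ ≤ 2 * (√(2*t))⁻¹ := by
  have hpos : 0 < 1 - Real.exp (-2*t) := by
    have : Real.exp (-2*t) < 1 := Real.exp_lt_one_iff.2 (by linarith)
    linarith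
  have hle : 1 - Real.exp (-2*t) ≤ 2*t := by
    have := Real.add_one_le_exp (-2*t)
    linarith
  have hge : 2*t / (1 + 2*t) ≤ 1 - Real.exp (-2*t) := by
    have h1 := Real.add_one_le_exp (2*t)
    have h2 : Real.exp (-2*t) ≤ 1 / (1 + 2*t) := by
      rw [show -2*t = -(2*t) by ring, Real.exp_neg, ← one_div]
      exact one_div_le_one_div_of_le (by positivity) (by linarith)
    have h3 : 2*t / (1 + 2*t) = 1 - 1 / (1 + 2*t) := by field_simp; ring
    linarith
  have hsq : ((√(1 - Real.exp (-2*t)))⁻¹) ^ 2 ≤ ((√(2*t))⁻¹) ^ 2 + 1 := by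
    rw [inv_pow, inv_pow, Real.sq_sqrt hpos.le, Real.sq_sqrt (by positivity)]
    calc (1 - Real.exp (-2*t))⁻¹ ≤ (2*t / (1 + 2*t))⁻¹ := by gcongr
      _ = (2*t)⁻¹ + 1 := by field_simp
  have hone : 1 ≤ 2 * ((√(2*t))⁻¹) ^ 2 := by
    rw [inv_pow, Real.sq_sqrt (by positivity)]
    field_simp
    linarith
  refine ⟨hpos, by gcongr, hsq, ?_⟩
  refine le_of_sq_le_sq ?_ (by positivity)
  nlinarith

/-- A Gaussian factor is dominated by the derivative of an arctangent. -/
lemma abs_mul_inv_sqrt_cube_div_le {t u : ℝ} (ht : 0 < t) :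
    |u| * ((√(2*t))⁻¹) ^ 3 / (1 + u^2 * ((√(2*t))⁻¹) ^ 2) ≤
      2 * (1 / (1 + (√t / |u|) ^ 2) * (1 / (2 * √t) / |u|)) := by
  rcases eq_or_ne u 0 with rfl | hu
  · simp
  have hu' : 0 < |u| := abs_pos.2 hu
  have hs : 0 < √t := Real.sqrt_pos.2 ht
  have hσ : 0 < √(2*t) := Real.sqrt_pos.2 (by positivity)
  have hle : √t ≤ √(2*t) := Real.sqrt_le_sqrt (by linarith)
  have hl : |u| * ((√(2*t))⁻¹) ^ 3 / (1 + u^2 * ((√(2*t))⁻¹) ^ 2) =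
      |u| / (√(2*t) * (√(2*t) ^ 2 + |u| ^ 2)) := by
    rw [← sq_abs u]; field_simp
  have hr : 2 * (1 / (1 + (√t / |u|) ^ 2) * (1 / (2 * √t) / |u|)) =
      |u| / (√t * (√t ^ 2 + |u| ^ 2)) := by
    field_simp
    ring
  rw [hl, hr]
  gcongr

set_option maxHeartbeats 800000 in
/-- Pointwise comparison of the Ornstein–Uhlenbeck and heat integrands. -/
lemma ou_heat_integrand_le {x y t : ℝ} (hxy : (x, y) ∈ Nreg 2) (ht : 0 < t) (ht1 : t ≤ 1)
    (htx : t * x^2 ≤ 1) :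
    |Real.exp (-5*t/2) * (1 - Real.exp (-2*t)) ^ (-(3:ℝ)/2) *
        Real.exp (-(Real.exp (-t) * x - y)^2 / (1 - Real.exp (-2*t))) -
      (2*t) ^ (-(3:ℝ)/2) * Real.exp (-(x-y)^2 / (2*t))| ≤
    2 * (13 + 8 * Real.exp 12 * (1 + x^2)) * (1 / (2 * √t)) +
      48 * Real.exp 12 * |x| *
        (1 / (1 + (√t / |x - y|) ^ 2) * (1 / (2 * √t) / |x - y|)) := by
  obtain ⟨ha, hρω, hω2, hω⟩ := inv_sqrt_comparison ht ht1
  have harct := abs_mul_inv_sqrt_cube_div_le (u := x - y) ht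
  have hσpos : 0 < √(2*t) := Real.sqrt_pos.2 (by positivity)
  have hρs : (√(2*t))⁻¹ ≤ 1 / √t := by
    rw [one_div]
    have := Real.sqrt_pos.2 ht
    gcongr
    linarith
  rw [rpow_neg_three_half ha, rpow_neg_three_half (by positivity : 0 < 2*t)]
  have hg : -(Real.exp (-t) * x - y)^2 / (1 - Real.exp (-2*t)) =
      -(((√(1 - Real.exp (-2*t)))⁻¹) ^ 2 * (Real.exp (-t) * x - y)^2) := by
    rw [inv_pow, Real.sq_sqrt ha.le]; field_simp
  have hh : -(x-y)^2 / (2*t) = -((x-y)^2 * ((√(2*t))⁻¹) ^ 2) := by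
    rw [inv_pow, Real.sq_sqrt (by positivity)]; field_simp
  rw [hg, hh]
  have htρ : t * ((√(2*t))⁻¹) ^ 2 = 1/2 := by
    rw [inv_pow, Real.sq_sqrt (by positivity)]; field_simp
  have hρ : 0 < (√(2*t))⁻¹ := by positivity
  generalize (√(2*t))⁻¹ = ρ at *
  generalize (√(1 - Real.exp (-2*t)))⁻¹ = ω at *
  have hωpos : 0 < ω := hρ.trans_le hρω
  -- the local region
  have hloc : |x - y| * (1 + |x| + |y|) ≤ 2 := (le_div_iff₀ (by positivity)).1 hxy
  have hux : |x - y| * |x| ≤ 2 := by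
    nlinarith [mul_nonneg (abs_nonneg (x - y)) (abs_nonneg y), abs_nonneg (x - y)]
  have hu : |x - y| ≤ 2 := by
    nlinarith [mul_nonneg (abs_nonneg (x - y)) (abs_nonneg y),
      mul_nonneg (abs_nonneg (x - y)) (abs_nonneg x)]
  have hu2 : (x - y)^2 ≤ 4 := by
    rw [← sq_abs]; nlinarith [abs_nonneg (x - y)]
  -- difference of the exponents
  have hb0 : 0 ≤ 1 - Real.exp (-t) := by
    have : Real.exp (-t) ≤ 1 := Real.exp_le_one_iff.2 (by linarith)
    linarith
  have hbt : 1 - Real.exp (-t) ≤ t := by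
    have := Real.add_one_le_exp (-t)
    linarith
  have hω3 : ω^2 ≤ 3 * ρ^2 := by nlinarith
  have hd : |ω^2 * (Real.exp (-t) * x - y)^2 - (x-y)^2 * ρ^2| ≤
      (x-y)^2 + 3 * (|x-y| * |x|) + 3/2 * (t * x^2) := by
    have heq : ω^2 * (Real.exp (-t) * x - y)^2 - (x-y)^2 * ρ^2 =
        (ω^2 - ρ^2) * (x-y)^2 + (-(2 * (ω^2 * (1 - Real.exp (-t))) * ((x-y) * x))) +
          (ω^2 * (1 - Real.exp (-t))) * (1 - Real.exp (-t)) * x^2 := by ring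
    have hωb : ω^2 * (1 - Real.exp (-t)) ≤ 3/2 := by
      calc ω^2 * (1 - Real.exp (-t)) ≤ (3 * ρ^2) * t := by gcongr
        _ = 3/2 := by linear_combination 3 * htρ
    have hωb0 : 0 ≤ ω^2 * (1 - Real.exp (-t)) := by positivity
    rw [heq]
    refine (abs_add_three _ _ _).trans (add_le_add (add_le_add ?_ ?_) ?_)
    · have : 0 ≤ ω^2 - ρ^2 := by nlinarith
      rw [abs_of_nonneg (by positivity)]
      nlinarith [sq_nonneg (x - y)]
    · rw [abs_neg, abs_mul, abs_mul (x - y), abs_of_nonneg (by positivity)]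
      gcongr
      linarith
    · rw [abs_of_nonneg (by positivity), mul_assoc]
      gcongr
  -- difference of the prefactors
  have he0 : 0 < Real.exp (-5*t/2) := Real.exp_pos _
  have he1 : Real.exp (-5*t/2) ≤ 1 := Real.exp_le_one_iff.2 (by linarith)
  have he2 : 1 - Real.exp (-5*t/2) ≤ 5/2 * t := by
    have := Real.add_one_le_exp (-5*t/2)
    linarith
  have hω8 : ω^3 ≤ 8 * ρ^3 := by
    calc ω^3 ≤ (2*ρ)^3 := by gcongr
      _ = 8 * ρ^3 := by ring
  have hpq : |Real.exp (-5*t/2) * ω^3 - ρ^3| ≤ 13 * ρ := by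
    have h1 : 0 ≤ ω^3 - ρ^3 := sub_nonneg.2 (by gcongr)
    have h2 : ω^3 - ρ^3 ≤ 3 * ρ := by
      have hmul : (ω^2 - ρ^2) * (ω + ρ) ≤ 1 * (ω + ρ) := by gcongr; linarith
      have hc : 0 ≤ (ω - ρ) * (ω * ρ) :=
        mul_nonneg (by linarith) (by positivity)
      linarith
    have h3 : 0 ≤ (1 - Real.exp (-5*t/2)) * ω^3 :=
      mul_nonneg (by linarith) (by positivity)
    have h4 : (1 - Real.exp (-5*t/2)) * ω^3 ≤ 10 * ρ := by
      calc (1 - Real.exp (-5*t/2)) * ω^3 ≤ (5/2 * t) * (8 * ρ^3) := by gcongr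
        _ = 10 * ρ := by linear_combination 20 * ρ * htρ
    rw [abs_le]
    constructor <;> linarith
  have hmain := abs_mul_exp_sub_mul_exp_le (p := Real.exp (-5*t/2) * ω^3) (q := ρ^3)
    (g := ω^2 * (Real.exp (-t) * x - y)^2) (h := (x-y)^2 * ρ^2) (D := 12)
    (by positivity) (by positivity) (by linarith)
  refine hmain.trans ?_
  have hp : Real.exp (-5*t/2) * ω^3 ≤ 8 * ρ^3 :=
    (mul_le_of_le_one_left (by positivity) he1).trans hω8
  -- the exponential decay
  have hE : Real.exp (-((x-y)^2 * ρ^2)) ≤ 1 / (1 + (x-y)^2 * ρ^2) := by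
    rw [Real.exp_neg, ← one_div]
    have := Real.add_one_le_exp ((x-y)^2 * ρ^2)
    exact one_div_le_one_div_of_le (by positivity) (by linarith)
  have hq1 : 1 / (1 + (x-y)^2 * ρ^2) ≤ 1 := by
    rw [div_le_one (by positivity)]
    nlinarith [mul_nonneg (sq_nonneg (x - y)) (sq_nonneg ρ)]
  have hq2 : (x-y)^2 * ρ^2 * (1 / (1 + (x-y)^2 * ρ^2)) ≤ 1 := by
    rw [mul_one_div, div_le_one (by positivity)]
    linarith
  have hq0 : 0 ≤ 1 / (1 + (x-y)^2 * ρ^2) := by positivity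
  have harct' : |x-y| * ρ^3 * (1 / (1 + (x-y)^2 * ρ^2)) ≤
      2 * (1 / (1 + (√t / |x - y|) ^ 2) * (1 / (2 * √t) / |x - y|)) := by
    rw [mul_one_div]; exact harct
  generalize 1 / (1 + (√t / |x - y|) ^ 2) * (1 / (2 * √t) / |x - y|) = Z at *
  generalize 1 / (1 + (x-y)^2 * ρ^2) = q at *
  have hstep : Real.exp (-5*t/2) * ω^3 * Real.exp 12 *
      (|ω^2 * (Real.exp (-t) * x - y)^2 - (x-y)^2 * ρ^2| * Real.exp (-((x-y)^2 * ρ^2))) ≤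
      8 * ρ^3 * Real.exp 12 * (((x-y)^2 + 3 * (|x-y| * |x|) + 3/2 * (t * x^2)) * q) := by
    gcongr
  have hrest : ρ^3 * (((x-y)^2 + 3 * (|x-y| * |x|) + 3/2 * (t * x^2)) * q) ≤
      ρ * (1 + x^2) + 6 * |x| * Z := by
    have e1 : ρ * ((x-y)^2 * ρ^2 * q) ≤ ρ * 1 := by gcongr
    have e2 : 3 * |x| * (|x-y| * ρ^3 * q) ≤ 3 * |x| * (2 * Z) := by gcongr
    have e3 : 3/4 * ρ * x^2 * q ≤ 3/4 * ρ * x^2 * 1 := by gcongr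
    have e4 : ρ^3 * (((x-y)^2 + 3 * (|x-y| * |x|) + 3/2 * (t * x^2)) * q) =
        ρ * ((x-y)^2 * ρ^2 * q) + 3 * |x| * (|x-y| * ρ^3 * q) + 3/4 * ρ * x^2 * q := by
      linear_combination 3/2 * ρ * x^2 * q * htρ
    have e5 : 0 ≤ ρ * x^2 := by positivity
    rw [e4]
    linarith
  have hfin : 8 * Real.exp 12 *
      (ρ^3 * (((x-y)^2 + 3 * (|x-y| * |x|) + 3/2 * (t * x^2)) * q)) ≤
      8 * Real.exp 12 * (ρ * (1 + x^2) + 6 * |x| * Z) := by gcongr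
  have hlast : (13 + 8 * Real.exp 12 * (1 + x^2)) * ρ ≤
      (13 + 8 * Real.exp 12 * (1 + x^2)) * (1 / √t) := by gcongr
  have hhalf : 2 * (13 + 8 * Real.exp 12 * (1 + x^2)) * (1 / (2 * √t)) =
      (13 + 8 * Real.exp 12 * (1 + x^2)) * (1 / √t) := by
    field_simp
  rw [hhalf]
  linarith

/-- The integral of the dominating function is controlled by its primitive. -/
lemma integrableOn_and_integral_sqrt_arctan (A B c : ℝ) (hA : 0 ≤ A) (hB : 0 ≤ B)
    (hc : 0 ≤ c) {m : ℝ} (hm : 0 ≤ m) :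
    IntegrableOn (fun t : ℝ => A * (1 / (2 * √t)) +
        B * (1 / (1 + (√t / c) ^ 2) * (1 / (2 * √t) / c))) (Set.Ioo 0 m) ∧
      ∫ t in Set.Ioo 0 m, (A * (1 / (2 * √t)) +
        B * (1 / (1 + (√t / c) ^ 2) * (1 / (2 * √t) / c))) =
        A * √m + B * Real.arctan (√m / c) := by
  have hcont : ContinuousOn (fun t : ℝ => A * √t + B * Real.arctan (√t / c)) (Set.Icc 0 m) := by
    have : Continuous (fun t : ℝ => √t / c) := Real.continuous_sqrt.div_const c
    exact ((continuous_const.mul Real.continuous_sqrt).add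
      (continuous_const.mul (Real.continuous_arctan.comp this))).continuousOn
  have hderiv : ∀ t ∈ Set.Ioo (0:ℝ) m,
      HasDerivAt (fun t : ℝ => A * √t + B * Real.arctan (√t / c))
        (A * (1 / (2 * √t)) + B * (1 / (1 + (√t / c) ^ 2) * (1 / (2 * √t) / c))) t := by
    intro t ht
    have hs := Real.hasDerivAt_sqrt ht.1.ne'
    exact (hs.const_mul A).add ((hs.div_const c).arctan.const_mul B)
  have hint := intervalIntegral.integrableOn_deriv_of_nonneg hcont hderiv
    (fun t _ => by positivity)
  refine ⟨hint.mono_set Set.Ioo_subset_Ioc_self, ?_⟩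
  rw [← integral_Ioc_eq_integral_Ioo, ← intervalIntegral.integral_of_le hm,
    intervalIntegral.integral_eq_sub_of_hasDerivAt_of_le hm hcont hderiv
      ((intervalIntegrable_iff_integrableOn_Ioc_of_le hm).2 hint)]
  simp

lemma mfun_pos (x : ℝ) : 0 < mfun x := by
  unfold mfun
  split_ifs with h
  · exact one_pos
  · exact lt_min one_pos (by positivity)

lemma mfun_le_one (x : ℝ) : mfun x ≤ 1 := by
  unfold mfun
  split_ifs
  · exact le_rfl
  · exact min_le_left _ _

lemma mfun_mul_sq_le_one (x : ℝ) : mfun x * x^2 ≤ 1 := by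
  unfold mfun
  split_ifs with h
  · simp [h]
  · exact (le_div_iff₀ (by positivity)).1 (min_le_right _ _)

lemma sqrt_mfun_mul_max_le_one (x : ℝ) : √(mfun x) * max 1 |x| ≤ 1 := by
  rcases max_choice 1 |x| with h | h <;> rw [h]
  · simpa using mfun_le_one x
  · rw [← Real.sqrt_sq_eq_abs, ← Real.sqrt_mul (mfun_pos x).le]
    simpa using mfun_mul_sq_le_one x

theorem ou_heat_comparison_first_term :
    ∃ C > (0:ℝ), ∀ x y : ℝ, (x, y) ∈ Nreg 2 →
      (∫ t in Set.Ioo 0 (mfun x),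
        |Real.exp (-5*t/2) * (1 - Real.exp (-2*t)) ^ (-(3:ℝ)/2) *
            Real.exp (-(Real.exp (-t) * x - y)^2 / (1 - Real.exp (-2*t))) -
          (2*t) ^ (-(3:ℝ)/2) * Real.exp (-(x-y)^2 / (2*t))|) ≤
        C * max 1 |x| := by
  refine ⟨26 + 200 * Real.exp 12, by positivity, fun x y hxy => ?_⟩
  obtain ⟨hint, hval⟩ := integrableOn_and_integral_sqrt_arctan
    (2 * (13 + 8 * Real.exp 12 * (1 + x^2))) (48 * Real.exp 12 * |x|) |x - y|
    (by positivity) (by positivity) (abs_nonneg _) (mfun_pos x).le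
  have hle := integral_mono_of_nonneg (ae_of_all _ fun t => abs_nonneg _) hint
    ((ae_restrict_iff' measurableSet_Ioo).2 (ae_of_all _ fun t ht =>
      ou_heat_integrand_le hxy ht.1 (ht.2.le.trans (mfun_le_one x))
        ((mul_le_mul_of_nonneg_right ht.2.le (sq_nonneg x)).trans (mfun_mul_sq_le_one x))))
  refine hle.trans ?_
  rw [hval]
  have hM := sqrt_mfun_mul_max_le_one x
  have hM1 : 1 ≤ max 1 |x| := le_max_left _ _
  have hMx : |x| ≤ max 1 |x| := le_max_right _ _
  have hxsq : x^2 ≤ (max 1 |x|)^2 := by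
    rw [← sq_abs]; gcongr
  generalize max 1 |x| = M at *
  have hs0 : 0 ≤ √(mfun x) := Real.sqrt_nonneg _
  have hs1 : √(mfun x) ≤ 1 := by nlinarith
  have harc : Real.arctan (√(mfun x) / |x - y|) ≤ 2 :=
    (Real.arctan_lt_pi_div_two _).le.trans (by linarith [Real.pi_le_four])
  have h1 : (1 + x^2) * √(mfun x) ≤ 2 * M := by
    calc (1 + x^2) * √(mfun x) ≤ (2 * M^2) * √(mfun x) := by gcongr; nlinarith
      _ = 2 * M * (√(mfun x) * M) := by ring
      _ ≤ 2 * M * 1 := by gcongr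
      _ = 2 * M := by ring
  have h2 : 48 * Real.exp 12 * |x| * Real.arctan (√(mfun x) / |x - y|) ≤
      48 * Real.exp 12 * M * 2 := by gcongr
  have h3 : 16 * Real.exp 12 * ((1 + x^2) * √(mfun x)) ≤ 16 * Real.exp 12 * (2 * M) := by gcongr
  have h4 : 0 ≤ Real.exp 12 * M := by positivity
  linarith
end

section
/- There is a constant C > 0 such that for all x, y ∈ ℝ and all 0 < t < 1, | (x-y)²/(2t)^{5/2} - e^{-3t/2} · (e^{-t}x - y)(x - e^{-t}y) / (1-e^{-2t})^{5/2} | ≤ C · t^{-3/2} · ( |e^{-t}x - y|·|x - e^{-t}y| + |x|·|x - e^{-t}y| + |y|·|e^{-t}x - y| + (x-y)² ). -/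
/-- With `a = 1 - s`, the difference `(x - y)² - (a x - y)(x - a y)` is of first order in `s`. -/
theorem abs_sq_sub_mul_le (x y a : ℝ) (ha : a ≤ 1) :
    |(x - y) ^ 2 - (a * x - y) * (x - a * y)| ≤
      2 * (1 - a) * (|a * x - y| * |x - a * y| + |x| * |x - a * y| + |y| * |a * x - y|
        + (x - y) ^ 2) := by
  have hs : 0 ≤ 1 - a := by linarith
  have key : (x - y) ^ 2 - (a * x - y) * (x - a * y) =
      (1 - a) * ((x * (x - a * y) - y * (a * x - y) + (x - y) ^ 2) / 2) := by
    ring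
  have hx := abs_mul x (x - a * y)
  have hy := abs_mul y (a * x - y)
  have hpq := mul_nonneg (abs_nonneg (a * x - y)) (abs_nonneg (x - a * y))
  rw [key, abs_mul, abs_of_nonneg hs, mul_comm 2, mul_assoc]
  refine mul_le_mul_of_nonneg_left ?_ hs
  have h1 := abs_le.mp (le_of_eq hx)
  have h2 := abs_le.mp (le_of_eq hy)
  have h3 := mul_nonneg (abs_nonneg x) (abs_nonneg (x - a * y))
  have h4 := mul_nonneg (abs_nonneg y) (abs_nonneg (a * x - y))
  rw [abs_le]
  constructor <;> nlinarith [sq_nonneg (x - y)]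

theorem exp_mul_sub_one_le {c t : ℝ} (hc : 0 ≤ c) (ht : 0 ≤ t) (ht1 : t ≤ 1) :
    Real.exp (c * t) - 1 ≤ c * Real.exp c * t := by
  have h1 := Real.add_one_le_exp (-(c * t))
  have h2 : Real.exp (c * t) * Real.exp (-(c * t)) = 1 := by
    rw [← Real.exp_add]; simp
  have h3 : Real.exp (c * t) ≤ Real.exp c := Real.exp_le_exp.mpr (by nlinarith)
  have h4 := Real.exp_pos (c * t)
  have h5 : 0 ≤ c * t := mul_nonneg hc ht
  nlinarith

theorem rpow_one_sub_exp_bounds {t : ℝ} (ht : 0 < t) :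
    Real.exp (-5 * t) * (2 * t) ^ ((5 : ℝ) / 2) ≤ (1 - Real.exp (-2 * t)) ^ ((5 : ℝ) / 2) ∧
      (1 - Real.exp (-2 * t)) ^ ((5 : ℝ) / 2) ≤ (2 * t) ^ ((5 : ℝ) / 2) := by
  have h1 := Real.add_one_le_exp (-2 * t)
  have h2 := Real.add_one_le_exp (2 * t)
  have h3 : Real.exp (-2 * t) * Real.exp (2 * t) = 1 := by
    rw [← Real.exp_add]; simp
  have h4 := Real.exp_pos (-2 * t)
  have h5 : Real.exp (-2 * t) * (2 * t) ≤ 1 - Real.exp (-2 * t) := by nlinarith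
  have h6 : Real.exp (-5 * t) = Real.exp (-2 * t) ^ ((5 : ℝ) / 2) := by
    rw [← Real.exp_mul]; ring_nf
  constructor
  · rw [h6, ← Real.mul_rpow h4.le (by positivity)]
    exact Real.rpow_le_rpow (by positivity) h5 (by norm_num)
  · refine Real.rpow_le_rpow (le_trans (by positivity) h5) (by linarith) (by norm_num)

theorem abs_inv_rpow_sub_exp_div_le {t : ℝ} (ht : 0 < t) (ht1 : t < 1) :
    |1 / (2 * t) ^ ((5 : ℝ) / 2) -
        Real.exp (-3 * t / 2) / (1 - Real.exp (-2 * t)) ^ ((5 : ℝ) / 2)| ≤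
      7 / 2 * Real.exp (7 / 2) * (t / (2 * t) ^ ((5 : ℝ) / 2)) := by
  obtain ⟨hl, hu⟩ := rpow_one_sub_exp_bounds ht
  have hD : 0 < (2 * t) ^ ((5 : ℝ) / 2) := by positivity
  set D := (2 * t) ^ ((5 : ℝ) / 2)
  set U := (1 - Real.exp (-2 * t)) ^ ((5 : ℝ) / 2)
  have hU : 0 < U := lt_of_lt_of_le (by positivity) hl
  have hupper : Real.exp (-3 * t / 2) / U ≤ Real.exp (7 / 2 * t) / D := by
    rw [div_le_div_iff₀ hU hD]
    have h : Real.exp (-3 * t / 2) = Real.exp (7 / 2 * t) * Real.exp (-5 * t) := by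
      rw [← Real.exp_add]; ring_nf
    rw [h, mul_assoc]
    exact mul_le_mul_of_nonneg_left hl (Real.exp_pos _).le
  have hlower : Real.exp (-3 * t / 2) / D ≤ Real.exp (-3 * t / 2) / U :=
    div_le_div_of_nonneg_left (Real.exp_pos _).le hU hu
  have h1 : (Real.exp (7 / 2 * t) - 1) / D ≤ 7 / 2 * Real.exp (7 / 2) * t / D := by
    have := exp_mul_sub_one_le (c := 7 / 2) (by norm_num) ht.le ht1.le
    gcongr
  have h2 : (1 - Real.exp (-3 * t / 2)) / D ≤ 7 / 2 * Real.exp (7 / 2) * t / D := by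
    have h3 := Real.add_one_le_exp (-3 * t / 2)
    have h4 : (1 : ℝ) ≤ Real.exp (7 / 2) := Real.one_le_exp (by norm_num)
    gcongr
    nlinarith
  rw [sub_div] at h1 h2
  rw [← mul_div_assoc, abs_le]
  constructor <;> linarith

theorem div_two_mul_rpow_le {t : ℝ} (ht : 0 < t) :
    t / (2 * t) ^ ((5 : ℝ) / 2) ≤ t ^ (-(3 : ℝ) / 2) := by
  rw [div_le_iff₀ (by positivity)]
  calc t = t ^ (-(3 : ℝ) / 2) * t ^ ((5 : ℝ) / 2) := by
        rw [← Real.rpow_add ht]; norm_num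
    _ ≤ t ^ (-(3 : ℝ) / 2) * (2 * t) ^ ((5 : ℝ) / 2) := by
        gcongr
        linarith

theorem pointwise_second_term_comparison :
    ∃ C > (0:ℝ), ∀ x y t : ℝ, 0 < t → t < 1 →
      |(x-y)^2 / (2*t) ^ ((5:ℝ)/2) -
          Real.exp (-3*t/2) * ((Real.exp (-t) * x - y) * (x - Real.exp (-t) * y)) /
            (1 - Real.exp (-2*t)) ^ ((5:ℝ)/2)| ≤
        C * t ^ (-(3:ℝ)/2) *
          (|Real.exp (-t) * x - y| * |x - Real.exp (-t) * y| +
            |x| * |x - Real.exp (-t) * y| + |y| * |Real.exp (-t) * x - y| + (x-y)^2) := by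
  refine ⟨2 + 7 / 2 * Real.exp (7 / 2), by positivity, fun x y t ht ht1 => ?_⟩
  have hP := abs_sq_sub_mul_le x y (Real.exp (-t)) (Real.exp_le_one_iff.mpr (by linarith))
  have hB := abs_inv_rpow_sub_exp_div_le ht ht1
  have ht' := div_two_mul_rpow_le ht
  have hs : 1 - Real.exp (-t) ≤ t := by linarith [Real.add_one_le_exp (-t)]
  have hD : 0 < (2 * t) ^ ((5 : ℝ) / 2) := by positivity
  set D := (2 * t) ^ ((5 : ℝ) / 2)
  set U := (1 - Real.exp (-2 * t)) ^ ((5 : ℝ) / 2)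
  set P := Real.exp (-t) * x - y
  set Q := x - Real.exp (-t) * y
  set S := |P| * |Q| + |x| * |Q| + |y| * |P| + (x - y) ^ 2 with hS
  set K := 7 / 2 * Real.exp (7 / 2)
  have hK : 0 ≤ K := by positivity
  have hS0 : 0 ≤ S := by positivity
  have hPQ : |P * Q| ≤ S := by
    rw [abs_mul, hS]
    linarith [mul_nonneg (abs_nonneg x) (abs_nonneg Q),
      mul_nonneg (abs_nonneg y) (abs_nonneg P), sq_nonneg (x - y)]
  calc |(x - y) ^ 2 / D - Real.exp (-3 * t / 2) * (P * Q) / U|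
      = |((x - y) ^ 2 - P * Q) / D + (1 / D - Real.exp (-3 * t / 2) / U) * (P * Q)| := by
        congr 1; ring
    _ ≤ |(x - y) ^ 2 - P * Q| / D + |1 / D - Real.exp (-3 * t / 2) / U| * |P * Q| := by
        refine (abs_add_le _ _).trans_eq ?_
        rw [abs_div, abs_of_pos hD, abs_mul]
    _ ≤ 2 * t * S / D + K * (t / D) * S := by
        gcongr
        exact hP.trans (by gcongr)
    _ = (2 + K) * (t / D) * S := by ring
    _ ≤ (2 + K) * t ^ (-(3 : ℝ) / 2) * S := by gcongr
end

section
/- There is a constant C > 0 such that for all (x,y) ∈ N₂, ∫_0^{m(x)} | e^{-3t/2} · (e^{-t}x - y)(x - e^{-t}y) · (1-e^{-2t})^{-5/2} · exp(-(e^{-t}x - y)²/(1-e^{-2t})) - (x-y)² · (2t)^{-5/2} · exp(-(x-y)²/(2t)) | dt ≤ C · max{1, |x|}, where m(x) = min{1, 1/x²} (interpreted as 1 when x = 0). -/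
open MeasureTheory Set

lemma rpow_neg_five_half {p : ℝ} (hp : 0 < p) :
    p ^ (-(5:ℝ)/2) = 1 / (p ^ 2 * √p) := by
  rw [show (-(5:ℝ)/2) = -((2:ℕ) + 1/2) by norm_num, Real.rpow_neg hp.le, Real.rpow_add hp,
    Real.rpow_natCast, Real.sqrt_eq_rpow, inv_eq_one_div]

lemma two_mul_div_le_one_sub_exp {t : ℝ} (ht : 0 < t) :
    2 * t / (1 + 2 * t) ≤ 1 - Real.exp (-2 * t) := by
  have h : Real.exp (-2 * t) ≤ 1 / (1 + 2 * t) := by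
    rw [show -2 * t = -(2 * t) by ring, Real.exp_neg, inv_eq_one_div]
    exact one_div_le_one_div_of_le (by positivity) (by linarith [Real.add_one_le_exp (2 * t)])
  have h2 : 2 * t / (1 + 2 * t) = 1 - 1 / (1 + 2 * t) := by field_simp; ring
  linarith

lemma one_sub_exp_rpow_le_s15 {t : ℝ} (ht : 0 < t) (ht1 : t ≤ 1) :
    (1 - Real.exp (-2 * t)) ^ (-(5:ℝ)/2) ≤ 3 / (t ^ 2 * √t) := by
  have hs : 2 * t / 3 ≤ 1 - Real.exp (-2 * t) :=
    le_trans (div_le_div_of_nonneg_left (by positivity) (by positivity) (by linarith))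
      (two_mul_div_le_one_sub_exp ht)
  refine le_trans (Real.rpow_le_rpow_of_nonpos (by positivity) hs (by norm_num)) ?_
  rw [rpow_neg_five_half (by positivity), show 2 * t / 3 = (2 / 3) * t by ring,
    Real.sqrt_mul (by norm_num)]
  have h1 : (3:ℝ) / 4 ≤ √(2 / 3) := Real.le_sqrt_of_sq_le (by norm_num)
  have h2 : 0 < √t := Real.sqrt_pos.2 ht
  rw [div_le_div_iff₀ (by positivity) (by positivity)]
  have h3 : 0 < t ^ 2 * √t := by positivity
  nlinarith [mul_le_mul_of_nonneg_left h1 h3.le]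

lemma two_mul_rpow_le {t : ℝ} (ht : 0 < t) :
    (2 * t) ^ (-(5:ℝ)/2) ≤ 1 / (t ^ 2 * √t) := by
  rw [← rpow_neg_five_half ht]
  exact Real.rpow_le_rpow_of_nonpos ht (by linarith) (by norm_num)

lemma exp_mul_one_sub_exp_rpow_le {t : ℝ} (ht : 0 < t) :
    Real.exp (-(5 * t / 2)) * (1 - Real.exp (-2 * t)) ^ (-(5:ℝ)/2) ≤ (2 * t) ^ (-(5:ℝ)/2) := by
  have hs : 0 ≤ 1 - Real.exp (-2 * t) := by
    linarith [Real.exp_le_one_iff.2 (show -2 * t ≤ 0 by linarith)]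
  rw [show -(5 * t / 2) = t * (-(5:ℝ)/2) by ring, Real.exp_mul,
    ← Real.mul_rpow (Real.exp_pos t).le hs]
  refine Real.rpow_le_rpow_of_nonpos (by positivity) ?_ (by norm_num)
  have h := Real.self_le_sinh_iff.2 ht.le
  rw [Real.sinh_eq] at h
  rw [mul_sub, ← Real.exp_add, show t + -2 * t = -t by ring]
  linarith

lemma le_exp_mul_one_sub_exp_rpow {t : ℝ} (ht : 0 < t) :
    (1 - 5 * t / 2) * (2 * t) ^ (-(5:ℝ)/2) ≤
      Real.exp (-(5 * t / 2)) * (1 - Real.exp (-2 * t)) ^ (-(5:ℝ)/2) := by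
  have hs : 0 < 1 - Real.exp (-2 * t) := by
    linarith [Real.exp_lt_one_iff.2 (show -2 * t < 0 by linarith)]
  gcongr ?_ * ?_
  · linarith [Real.add_one_le_exp (-(5 * t / 2))]
  · exact Real.rpow_le_rpow_of_nonpos hs (by linarith [Real.add_one_le_exp (-2 * t)]) (by norm_num)

lemma abs_exp_neg_sub_exp_neg_le {a b c : ℝ} (hc : 0 ≤ c) (h : b - c ≤ a) :
    |Real.exp (-a) - Real.exp (-b)| ≤ |a - b| * (Real.exp c * Real.exp (-b)) := by
  rw [← Real.exp_add]
  rcases le_total a b with hab | hab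
  · rw [abs_of_nonneg (by simpa using hab), abs_of_nonpos (by linarith)]
    have h1 : Real.exp (-a) - Real.exp (-b) ≤ (b - a) * Real.exp (-a) := by
      have : Real.exp (-b) = Real.exp (-a) * Real.exp (a - b) := by rw [← Real.exp_add]; ring_nf
      rw [this]
      nlinarith [Real.add_one_le_exp (a - b), Real.exp_pos (-a)]
    refine h1.trans ?_
    rw [neg_sub]
    gcongr
    linarith
  · rw [abs_of_nonpos (by simpa using hab), abs_of_nonneg (by linarith)]
    have h1 : Real.exp (-b) - Real.exp (-a) ≤ (a - b) * Real.exp (-b) := by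
      have : Real.exp (-a) = Real.exp (-b) * Real.exp (b - a) := by rw [← Real.exp_add]; ring_nf
      rw [this]
      nlinarith [Real.add_one_le_exp (b - a), Real.exp_pos (-b)]
    rw [neg_sub]
    refine h1.trans ?_
    gcongr
    linarith

lemma mul_exp_neg_half_le {z : ℝ} : z * Real.exp (-(z / 2)) ≤ 2 := by
  rw [Real.exp_neg, ← div_eq_mul_inv, div_le_iff₀ (Real.exp_pos _)]
  linarith [Real.add_one_le_exp (z / 2)]

lemma sq_mul_exp_neg_half_le {z : ℝ} (hz : 0 ≤ z) : z ^ 2 * Real.exp (-(z / 2)) ≤ 8 := by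
  rw [Real.exp_neg, ← div_eq_mul_inv, div_le_iff₀ (Real.exp_pos _)]
  linarith [Real.quadratic_le_exp_of_nonneg (show 0 ≤ z / 2 by positivity)]

/-- Comparison of the Mehler and the Gaussian exponents. -/
lemma abs_exponent_sub_le {x d t : ℝ} (ht : 0 < t) (hdx : |d| * |x| ≤ 2) :
    |(d - (1 - Real.exp (-t)) * x) ^ 2 / (1 - Real.exp (-2 * t)) - d ^ 2 / (2 * t)| ≤
        d ^ 2 + 2 * (|d| * |x|) + t * x ^ 2 ∧
      d ^ 2 / (2 * t) - 4 ≤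
        (d - (1 - Real.exp (-t)) * x) ^ 2 / (1 - Real.exp (-2 * t)) := by
  have hslow := two_mul_div_le_one_sub_exp ht
  have hshigh : 1 - Real.exp (-2 * t) ≤ 2 * t := by linarith [Real.add_one_le_exp (-2 * t)]
  have hr : Real.exp (-2 * t) = Real.exp (-t) ^ 2 := by
    rw [← Real.exp_nat_mul]; congr 1; push_cast; ring
  have hr0 := Real.exp_pos (-t)
  have hr1 : Real.exp (-t) < 1 := Real.exp_lt_one_iff.2 (by linarith)
  have hrt : 1 - Real.exp (-t) ≤ t := by linarith [Real.add_one_le_exp (-t)]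
  have hs0 : 0 < 1 - Real.exp (-2 * t) := lt_of_lt_of_le (by positivity) hslow
  have hi1 : 1 / (2 * t) ≤ 1 / (1 - Real.exp (-2 * t)) := one_div_le_one_div_of_le hs0 hshigh
  have hi2 : 1 / (1 - Real.exp (-2 * t)) ≤ 1 / (2 * t) + 1 := by
    refine (one_div_le_one_div_of_le (by positivity) hslow).trans (le_of_eq ?_)
    field_simp
  have hus : 1 - Real.exp (-2 * t) = (1 - Real.exp (-t)) * (1 + Real.exp (-t)) := by rw [hr]; ring
  generalize 1 - Real.exp (-2 * t) = s at *
  obtain ⟨q, hq⟩ : ∃ q, q = 1 / (1 + Real.exp (-t)) := ⟨_, rfl⟩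
  have hq0 : 0 < q := by rw [hq]; positivity
  have hq1 : q ≤ 1 := by rw [hq, div_le_one (by positivity)]; linarith
  have hu : 0 < 1 - Real.exp (-t) := by linarith
  have hexp : (d - (1 - Real.exp (-t)) * x) ^ 2 / s =
      d ^ 2 * (1 / s) - 2 * (q * (d * x)) + q * ((1 - Real.exp (-t)) * x ^ 2) := by
    rw [hq, hus]; field_simp; ring
  have hb : d ^ 2 / (2 * t) = d ^ 2 * (1 / (2 * t)) := by ring
  have hdx' : |q * (d * x)| ≤ |d| * |x| := by
    rw [abs_mul, abs_of_pos hq0, abs_mul]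
    exact mul_le_of_le_one_left (by positivity) hq1
  obtain ⟨h5, h6⟩ := abs_le.1 hdx'
  have h1 := mul_le_mul_of_nonneg_left hi1 (sq_nonneg d)
  have h2 := mul_le_mul_of_nonneg_left hi2 (sq_nonneg d)
  have h3 : 0 ≤ q * ((1 - Real.exp (-t)) * x ^ 2) := by positivity
  have h4 : q * ((1 - Real.exp (-t)) * x ^ 2) ≤ t * x ^ 2 :=
    (mul_le_of_le_one_left (by positivity) hq1).trans (by gcongr)
  have h7 : 0 ≤ t * x ^ 2 := by positivity
  rw [hexp, hb]
  refine ⟨abs_le.2 ⟨?_, ?_⟩, ?_⟩ <;> nlinarith [sq_nonneg d]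

/-- An integrable majorant of the difference of kernels, chosen to have an explicit primitive. -/
noncomputable def majorant (x d t : ℝ) : ℝ :=
  (1 + x ^ 2) * (1 / √t) + |x| * (1 / (1 + (√t / |d|) ^ 2) * (1 / √t / |d|))

lemma gaussian_moment_le_majorant {x d t : ℝ} (ht : 0 < t) :
    d ^ 2 * (1 / (t ^ 2 * √t)) * Real.exp (-(d ^ 2 / (2 * t))) *
      (d ^ 2 + 2 * (|d| * |x|) + t * x ^ 2) ≤ 20 * majorant x d t := by
  have hw : 0 < √t := Real.sqrt_pos.2 ht
  rcases eq_or_ne d 0 with rfl | hd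
  · simp only [majorant]
    simp
    positivity
  have hδ : 0 < |d| := abs_pos.2 hd
  obtain ⟨z, hz⟩ : ∃ z, z = d ^ 2 / t := ⟨_, rfl⟩
  have hz0 : 0 ≤ z := by rw [hz]; positivity
  have hd2 : d ^ 2 = z * t := by rw [hz]; field_simp
  have hmaj : majorant x d t = (1 + x ^ 2) / √t + |x| * |d| / (t * √t * (1 + z)) := by
    rw [majorant, div_pow, Real.sq_sqrt ht.le, sq_abs, hd2]
    have hzp : 0 < z := by rw [hz]; positivity
    have : |d| ^ 2 = z * t := by rw [sq_abs, hd2]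
    field_simp
    linear_combination (-(|x| * (1 + z))) * this
  have he : d ^ 2 / (2 * t) = z / 2 := by rw [hd2]; field_simp
  have e1 := mul_exp_neg_half_le (z := z)
  have e2 := sq_mul_exp_neg_half_le hz0
  rw [hmaj, he]
  generalize Real.exp (-(z / 2)) = e at *
  have hl : d ^ 2 * (1 / (t ^ 2 * √t)) * e * (d ^ 2 + 2 * (|d| * |x|) + t * x ^ 2) =
      (z ^ 2 * e) / √t + x ^ 2 * (z * e) / √t +
        2 * (z * e + z ^ 2 * e) * (|x| * |d| / (t * √t * (1 + z))) := by
    rw [hd2]; field_simp; ring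
  rw [hl]
  have i1 : (z ^ 2 * e) / √t ≤ 8 / √t := by gcongr
  have i2 : x ^ 2 * (z * e) / √t ≤ x ^ 2 * 2 / √t := by gcongr
  have i3 : 2 * (z * e + z ^ 2 * e) * (|x| * |d| / (t * √t * (1 + z))) ≤
      20 * (|x| * |d| / (t * √t * (1 + z))) := by
    gcongr; linarith
  have i4 : 8 / √t + x ^ 2 * 2 / √t ≤ 20 * ((1 + x ^ 2) / √t) := by
    rw [← add_div, ← mul_div_assoc]; gcongr; nlinarith [sq_nonneg x]
  linarith

lemma kernel_difference_le {x y t : ℝ} (ht : 0 < t) (ht1 : t ≤ 1) (hdx : |x - y| * |x| ≤ 2) :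
    |Real.exp (-3*t/2) * ((Real.exp (-t) * x - y) * (x - Real.exp (-t) * y)) *
          (1 - Real.exp (-2*t)) ^ (-(5:ℝ)/2) *
          Real.exp (-(Real.exp (-t) * x - y)^2 / (1 - Real.exp (-2*t))) -
        (x-y)^2 * (2*t) ^ (-(5:ℝ)/2) * Real.exp (-(x-y)^2 / (2*t))| ≤
      (20 * Real.exp 4 + 20) * majorant x (x - y) t := by
  obtain ⟨d, hd⟩ : ∃ d, d = x - y := ⟨_, rfl⟩
  have hy : y = x - d := by linarith
  rw [← hd] at hdx ⊢
  have hw : 0 < √t := Real.sqrt_pos.2 ht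
  have hu0 : 0 ≤ 1 - Real.exp (-t) := by
    linarith [Real.exp_le_one_iff.2 (show -t ≤ 0 by linarith)]
  have hut : 1 - Real.exp (-t) ≤ t := by linarith [Real.add_one_le_exp (-t)]
  have hs0 : 0 ≤ 1 - Real.exp (-2 * t) :=
    le_trans (by positivity) (two_mul_div_le_one_sub_exp ht)
  obtain ⟨hab, hba⟩ := abs_exponent_sub_le ht hdx
  have hE := abs_exp_neg_sub_exp_neg_le (by norm_num) hba
  have hS := one_sub_exp_rpow_le_s15 ht ht1
  have hP := two_mul_rpow_le ht
  have hQ1 := exp_mul_one_sub_exp_rpow_le ht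
  have hQ2 := le_exp_mul_one_sub_exp_rpow ht
  have hM := gaussian_moment_le_majorant (x := x) (d := d) ht
  have hS0 : 0 ≤ (1 - Real.exp (-2 * t)) ^ (-(5:ℝ)/2) := Real.rpow_nonneg hs0 _
  have hP0 : 0 ≤ (2 * t) ^ (-(5:ℝ)/2) := by positivity
  have hr : Real.exp (-(5 * t / 2)) = Real.exp (-3*t/2) * Real.exp (-t) := by
    rw [← Real.exp_add]; ring_nf
  have hr0 : Real.exp (-3*t/2) ≤ 1 := Real.exp_le_one_iff.2 (by linarith)
  have harg : Real.exp (-t) * x - y = d - (1 - Real.exp (-t)) * x := by rw [hd]; ring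
  have hprod : (Real.exp (-t) * x - y) * (x - Real.exp (-t) * y) =
      Real.exp (-t) * d ^ 2 - (1 - Real.exp (-t)) ^ 2 * (x * y) := by rw [hd]; ring
  rw [hprod, harg, neg_div _ ((d - _) ^ 2), neg_div _ (d ^ 2)]
  rw [hr] at hQ1 hQ2
  have hE1 : Real.exp (-((d - (1 - Real.exp (-t)) * x) ^ 2 / (1 - Real.exp (-2 * t)))) ≤ 1 :=
    Real.exp_le_one_iff.2 (neg_nonpos.2 (by positivity))
  have hE10 := Real.exp_pos (-((d - (1 - Real.exp (-t)) * x) ^ 2 / (1 - Real.exp (-2 * t))))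
  have hxy : |x * y| ≤ x ^ 2 + 2 := by
    rw [hy, show x * (x - d) = x ^ 2 - d * x by ring]
    refine (abs_sub _ _).trans ?_
    rw [abs_mul, abs_of_nonneg (sq_nonneg x)]
    linarith
  have hze : d ^ 2 / t * Real.exp (-(d ^ 2 / (2 * t))) ≤ 2 := by
    have := mul_exp_neg_half_le (z := d ^ 2 / t)
    rwa [show d ^ 2 / t / 2 = d ^ 2 / (2 * t) by field_simp] at this
  have hr00 := Real.exp_pos (-3*t/2)
  have hE20 := Real.exp_pos (-(d ^ 2 / (2 * t)))
  generalize Real.exp (-((d - (1 - Real.exp (-t)) * x) ^ 2 / (1 - Real.exp (-2 * t)))) = E₁ at *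
  generalize (d - (1 - Real.exp (-t)) * x) ^ 2 / (1 - Real.exp (-2 * t)) = a at *
  generalize (1 - Real.exp (-2 * t)) ^ (-(5:ℝ)/2) = S at *
  generalize (2 * t) ^ (-(5:ℝ)/2) = P at *
  generalize Real.exp (-(d ^ 2 / (2 * t))) = E₂ at *
  generalize Real.exp (-3*t/2) = ρ at *
  have hmaj : (1 + x ^ 2) * (1 / √t) ≤ majorant x d t := by
    rw [majorant]
    exact le_add_of_nonneg_right (by positivity)
  have b1 : |ρ * ((1 - Real.exp (-t)) ^ 2 * (x * y)) * S * E₁| ≤ 6 * majorant x d t := by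
    rw [abs_mul, abs_mul, abs_mul, abs_mul, abs_of_pos hr00, abs_of_nonneg hS0, abs_of_pos hE10,
      abs_of_nonneg (sq_nonneg (1 - Real.exp (-t)))]
    calc ρ * ((1 - Real.exp (-t)) ^ 2 * |x * y|) * S * E₁
        ≤ 1 * (t ^ 2 * (x ^ 2 + 2)) * (3 / (t ^ 2 * √t)) * 1 := by gcongr
      _ = (3 * x ^ 2 + 6) * (1 / √t) := by field_simp; ring
      _ ≤ 6 * ((1 + x ^ 2) * (1 / √t)) := by
          rw [← mul_assoc]; gcongr; nlinarith [sq_nonneg x]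
      _ ≤ _ := by gcongr
  have b2 : |d ^ 2 * (ρ * Real.exp (-t) * S) * (E₁ - E₂)| ≤
      20 * Real.exp 4 * majorant x d t := by
    rw [abs_mul, abs_of_nonneg (by positivity)]
    calc d ^ 2 * (ρ * Real.exp (-t) * S) * |E₁ - E₂|
        ≤ d ^ 2 * (1 / (t ^ 2 * √t)) *
          ((d ^ 2 + 2 * (|d| * |x|) + t * x ^ 2) * (Real.exp 4 * E₂)) := by
          gcongr
          · exact hQ1.trans hP
          · exact hE.trans (by gcongr)
      _ = Real.exp 4 * (d ^ 2 * (1 / (t ^ 2 * √t)) * E₂ *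
            (d ^ 2 + 2 * (|d| * |x|) + t * x ^ 2)) := by ring
      _ ≤ Real.exp 4 * (20 * majorant x d t) := by gcongr
      _ = _ := by ring
  have b3 : |d ^ 2 * (P - ρ * Real.exp (-t) * S) * E₂| ≤ 5 * majorant x d t := by
    have hPQ : 0 ≤ P - ρ * Real.exp (-t) * S := by linarith
    rw [abs_of_nonneg (by positivity)]
    calc d ^ 2 * (P - ρ * Real.exp (-t) * S) * E₂
        ≤ d ^ 2 * (5 * t / 2 * (1 / (t ^ 2 * √t))) * E₂ := by
          gcongr
          exact le_trans (show _ ≤ 5 * t / 2 * P by linarith) (by gcongr)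
      _ = 5 / 2 * (d ^ 2 / t * E₂) * (1 / √t) := by field_simp
      _ ≤ 5 / 2 * 2 * (1 / √t) := by gcongr
      _ = 5 * (1 * (1 / √t)) := by ring
      _ ≤ 5 * ((1 + x ^ 2) * (1 / √t)) := by gcongr; nlinarith [sq_nonneg x]
      _ ≤ _ := by gcongr
  have hmaj0 : 0 ≤ majorant x d t := le_trans (by positivity) hmaj
  rw [show ρ * (Real.exp (-t) * d ^ 2 - (1 - Real.exp (-t)) ^ 2 * (x * y)) * S * E₁ -
      d ^ 2 * P * E₂ = d ^ 2 * (ρ * Real.exp (-t) * S) * (E₁ - E₂) -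
        d ^ 2 * (P - ρ * Real.exp (-t) * S) * E₂ -
        ρ * ((1 - Real.exp (-t)) ^ 2 * (x * y)) * S * E₁ by ring]
  have c1 := abs_sub (d ^ 2 * (ρ * Real.exp (-t) * S) * (E₁ - E₂) -
        d ^ 2 * (P - ρ * Real.exp (-t) * S) * E₂)
        (ρ * ((1 - Real.exp (-t)) ^ 2 * (x * y)) * S * E₁)
  have c2 := abs_sub (d ^ 2 * (ρ * Real.exp (-t) * S) * (E₁ - E₂))
        (d ^ 2 * (P - ρ * Real.exp (-t) * S) * E₂)
  linarith

lemma integral_majorant_le {x d m : ℝ} (hm : 0 ≤ m) :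
    IntegrableOn (majorant x d) (Ioo 0 m) ∧
      ∫ t in Ioo 0 m, majorant x d t ≤ 2 * (1 + x ^ 2) * √m + 4 * |x| := by
  let F : ℝ → ℝ := fun t => (1 + x ^ 2) * (2 * √t) + |x| * (2 * Real.arctan (√t / |d|))
  have hc : ContinuousOn F (Icc 0 m) := by
    apply Continuous.continuousOn
    simp only [F]
    have := Real.continuous_arctan
    fun_prop
  have hderiv : ∀ t ∈ Ioo 0 m, HasDerivAt F (majorant x d t) t := by
    intro t ht
    have h := Real.hasDerivAt_sqrt ht.1.ne'
    have h2 := ((h.const_mul 2).const_mul (1 + x ^ 2)).add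
      ((((h.div_const |d|).arctan).const_mul 2).const_mul |x|)
    refine h2.congr_deriv ?_
    have hw : 0 < √t := Real.sqrt_pos.2 ht.1
    rw [majorant]
    ring
  have hint : IntegrableOn (majorant x d) (Ioc 0 m) :=
    intervalIntegral.integrableOn_deriv_of_nonneg hc hderiv
      (fun t _ => by rw [majorant]; positivity)
  refine ⟨hint.mono_set Ioo_subset_Ioc_self, ?_⟩
  rw [← integral_Ioc_eq_integral_Ioo, ← intervalIntegral.integral_of_le hm,
    intervalIntegral.integral_eq_sub_of_hasDerivAt_of_le hm hc hderiv
      ((intervalIntegrable_iff_integrableOn_Ioc_of_le hm).2 hint)]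
  simp only [F, Real.sqrt_zero, zero_div, Real.arctan_zero, mul_zero, add_zero, sub_zero]
  have h1 : 2 * Real.arctan (√m / |d|) ≤ 4 := by
    linarith [Real.arctan_lt_pi_div_two (√m / |d|), Real.pi_le_four]
  nlinarith [mul_le_mul_of_nonneg_left h1 (abs_nonneg x)]

lemma one_add_sq_mul_sqrt_mfun_le (x : ℝ) : (1 + x ^ 2) * √(mfun x) ≤ 2 * max 1 |x| := by
  rcases le_total |x| 1 with h | h
  · have h1 : √(mfun x) ≤ 1 := Real.sqrt_le_one.2 (mfun_le_one x)
    have h2 : x ^ 2 ≤ 1 := (sq_le_one_iff_abs_le_one x).2 h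
    rw [max_eq_left h]
    nlinarith [Real.sqrt_nonneg (mfun x), sq_nonneg x]
  · have hx : x ≠ 0 := by rintro rfl; simp at h; linarith
    have h1 : √(mfun x) ≤ 1 / |x| := by
      refine Real.sqrt_le_iff.2 ⟨by positivity, ?_⟩
      rw [mfun, if_neg hx, div_pow, sq_abs, one_pow]
      exact min_le_right _ _
    rw [max_eq_right h]
    calc (1 + x ^ 2) * √(mfun x) ≤ (|x| ^ 2 + |x| ^ 2) * (1 / |x|) := by
          rw [← sq_abs x]; gcongr; nlinarith
      _ = 2 * |x| := by field_simp; ring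

lemma abs_sub_mul_abs_le_of_mem_Nreg {s x y : ℝ} (h : (x, y) ∈ Nreg s) :
    |x - y| * |x| ≤ s := by
  have h' : |x - y| ≤ s / (1 + |x| + |y|) := h
  rw [le_div_iff₀ (by positivity)] at h'
  nlinarith [mul_nonneg (abs_nonneg (x - y)) (abs_nonneg y), abs_nonneg (x - y)]

theorem ou_heat_comparison_second_term :
    ∃ C > (0:ℝ), ∀ x y : ℝ, (x, y) ∈ Nreg 2 →
      (∫ t in Set.Ioo 0 (mfun x),
        |Real.exp (-3*t/2) * ((Real.exp (-t) * x - y) * (x - Real.exp (-t) * y)) *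
            (1 - Real.exp (-2*t)) ^ (-(5:ℝ)/2) *
            Real.exp (-(Real.exp (-t) * x - y)^2 / (1 - Real.exp (-2*t))) -
          (x-y)^2 * (2*t) ^ (-(5:ℝ)/2) * Real.exp (-(x-y)^2 / (2*t))|) ≤
        C * max 1 |x| := by
  refine ⟨(20 * Real.exp 4 + 20) * 8, by positivity, fun x y hxy => ?_⟩
  have hdx := abs_sub_mul_abs_le_of_mem_Nreg hxy
  obtain ⟨hint, hle⟩ := integral_majorant_le (x := x) (d := x - y) (mfun_pos x).le
  have hpt : ∀ᵐ t ∂(volume.restrict (Ioo 0 (mfun x))), _ ≤ _ :=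
    (ae_restrict_mem measurableSet_Ioo).mono fun t ht =>
      kernel_difference_le ht.1 (ht.2.le.trans (mfun_le_one x)) hdx
  refine (integral_mono_of_nonneg (ae_of_all _ fun t => abs_nonneg _)
    (hint.const_mul _) hpt).trans ?_
  rw [integral_const_mul, mul_assoc]
  gcongr
  linarith [one_add_sq_mul_sqrt_mfun_le x, le_max_right 1 |x|]
end

section
/- There is a constant C > 0 such that for every measurable function φ : (0,∞) → ℂ, every A > 0 with |φ(t)| ≤ A for almost every t > 0, and all (x,y) ∈ N₂ with x ≠ y, the integrals defining B_φ^O(x,y) and K_φ(x,y) converge absolutely and | e^{-y²} · B_φ^O(x,y) - K_φ(x,y) | ≤ C · A · max{1, |x|}. -/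
open MeasureTheory Set

/-- The Ornstein–Uhlenbeck heat kernel `W_t^O(x,y)`. -/
noncomputable def WO (t x y : ℝ) : ℝ :=
  (1 / Real.sqrt (Real.pi * (1 - Real.exp (-2*t)))) *
    Real.exp (-(Real.exp (-t) * x - y)^2 / (1 - Real.exp (-2*t)) + y^2)

/-- The classical heat kernel `W_t(x,y)`. -/
noncomputable def Wheat (t x y : ℝ) : ℝ :=
  (1 / Real.sqrt (2 * Real.pi * t)) * Real.exp (-(x-y)^2 / (2*t))

/-- The kernel `B_φ^O(x,y) = ∫_0^∞ φ(t) (-∂_t)(e^{-t/2} W_t^O(x,y)) dt`. -/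
noncomputable def BO (φ : ℝ → ℂ) (x y : ℝ) : ℂ :=
  ∫ t in Set.Ioi (0:ℝ),
    φ t * ((-(deriv (fun s => Real.exp (-s/2) * WO s x y) t) : ℝ) : ℂ)

/-- The kernel `K_φ(x,y) = ∫_0^∞ φ(t) (-∂_t W_t(x,y)) dt`. -/
noncomputable def Kheat (φ : ℝ → ℂ) (x y : ℝ) : ℂ :=
  ∫ t in Set.Ioi (0:ℝ), φ t * ((-(deriv (fun s => Wheat s x y) t) : ℝ) : ℂ)

namespace OUComparison

open Real

/-- Logarithm of the classical heat kernel, with `D = (x - y)²`. -/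
noncomputable def logHeat (D t : ℝ) : ℝ :=
  -(log (2 * π) / 2) - log t / 2 - D / (2 * t)

/-- Logarithm of `e^{-y²} e^{-t/2} W_t^O(x,y)`, with `D = (x - y)²`, `p = x y` and
`c = (x² - y²) / 2`. -/
noncomputable def logMehler (D p c t : ℝ) : ℝ :=
  -(log (2 * π) / 2) - log (sinh t) / 2 - D / 2 * (cosh t / sinh t)
    - p * ((cosh t - 1) / sinh t) + c

lemma one_div_sqrt_eq_exp {z : ℝ} (hz : 0 < z) : 1 / √z = exp (-(log z / 2)) := by
  rw [exp_neg, exp_half, exp_log hz, one_div]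

lemma Wheat_eq_exp {t : ℝ} (ht : 0 < t) (x y : ℝ) :
    Wheat t x y = exp (logHeat ((x - y) ^ 2) t) := by
  have hpi := pi_pos
  rw [Wheat, one_div_sqrt_eq_exp (by positivity), ← exp_add, logHeat,
    log_mul (by positivity) ht.ne']
  congr 1
  ring

lemma exp_mul_WO_eq_exp {t : ℝ} (ht : 0 < t) (x y : ℝ) :
    exp (-y ^ 2) * (exp (-t / 2) * WO t x y) =
      exp (logMehler ((x - y) ^ 2) (x * y) ((x ^ 2 - y ^ 2) / 2) t) := by
  have hpi := pi_pos
  have hs : 0 < sinh t := sinh_pos_iff.2 ht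
  have h1 : 1 - exp (-2 * t) = 2 * exp (-t) * sinh t := by
    have h2 : exp (-2 * t) = exp (-t) * exp (-t) := by rw [← exp_add]; congr 1; ring
    have h3 : exp t * exp (-t) = 1 := by rw [← exp_add]; simp
    rw [h2, sinh_eq]
    linear_combination (-1) * h3
  have h4 : log (π * (2 * exp (-t) * sinh t)) = log (2 * π) - t + log (sinh t) := by
    rw [show π * (2 * exp (-t) * sinh t) = (2 * π) * exp (-t) * sinh t by ring,
      log_mul (by positivity) hs.ne', log_mul (by positivity) (by positivity), log_exp]
    ring
  have h5 : (exp (-t) * x - y) ^ 2 / (2 * exp (-t) * sinh t) =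
      (x - y) ^ 2 / 2 * (cosh t / sinh t) + x * y * ((cosh t - 1) / sinh t)
        - (x ^ 2 - y ^ 2) / 2 := by
    have h6 : exp t * exp (-t) = 1 := by rw [← exp_add]; simp
    have h7 : exp (-t) = cosh t - sinh t := by rw [cosh_sub_sinh]
    have h8 : exp (-t) ≠ 0 := (exp_pos _).ne'
    have h9 : cosh t ^ 2 - sinh t ^ 2 = 1 := cosh_sq_sub_sinh_sq t
    rw [h7] at h8 ⊢
    field_simp
    linear_combination (y ^ 2) * (-1) * h9
  rw [WO, h1, one_div_sqrt_eq_exp (by positivity), h4, ← exp_add, ← exp_add, ← exp_add, logMehler,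
    neg_div _ ((exp (-t) * x - y) ^ 2), h5]
  congr 1
  ring

lemma hasDerivAt_logHeat (D : ℝ) {t : ℝ} (ht : 0 < t) :
    HasDerivAt (logHeat D) (-(1 / (2 * t)) + D / (2 * t ^ 2)) t := by
  have h1 := (((hasDerivAt_log ht.ne').div_const 2).const_sub (-(log (2 * π) / 2))).sub
    (((hasDerivAt_inv ht.ne').const_mul (D / 2)))
  refine (h1.congr_deriv ?_).congr_of_eventuallyEq ?_
  · field_simp
    ring
  · filter_upwards with s
    simp only [logHeat, Pi.sub_apply]
    rw [mul_comm 2 s, ← div_div, div_right_comm, div_eq_mul_inv (D / 2)]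

lemma hasDerivAt_logMehler (D p c : ℝ) {t : ℝ} (ht : 0 < t) :
    HasDerivAt (logMehler D p c)
      (-(cosh t / sinh t / 2) + D / (2 * sinh t ^ 2) - p / (cosh t + 1)) t := by
  have hs : 0 < sinh t := sinh_pos_iff.2 ht
  have hc : 0 < cosh t := cosh_pos t
  have h9 : cosh t ^ 2 - sinh t ^ 2 = 1 := cosh_sq_sub_sinh_sq t
  have h1 := ((((((hasDerivAt_sinh t).log hs.ne').div_const 2).const_sub (-(log (2 * π) / 2))).sub
    (((hasDerivAt_cosh t).div (hasDerivAt_sinh t) hs.ne').const_mul (D / 2))).sub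
    ((((hasDerivAt_cosh t).sub_const 1).div (hasDerivAt_sinh t) hs.ne').const_mul p)).add_const c
  refine h1.congr_deriv ?_
  have e1 : (sinh t * sinh t - cosh t * cosh t) / sinh t ^ 2 = -1 / sinh t ^ 2 := by
    congr 1; linear_combination -h9
  have e2 : (sinh t * sinh t - (cosh t - 1) * cosh t) / sinh t ^ 2 = 1 / (cosh t + 1) := by
    rw [div_eq_div_iff (by positivity) (by positivity)]
    linear_combination (-cosh t) * h9
  rw [e1, e2]
  field_simp
  ring

/-! ### Elementary hyperbolic estimates -/

lemma self_le_sinh {t : ℝ} (ht : 0 < t) : t ≤ sinh t := self_le_sinh_iff.2 ht.le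

lemma sinh_le_mul_cosh {t : ℝ} (ht : 0 < t) : sinh t ≤ t * cosh t := by
  have h : MonotoneOn (fun s => s * cosh s - sinh s) (Ici 0) := by
    refine monotoneOn_of_deriv_nonneg (convex_Ici 0) (by fun_prop) (by fun_prop) ?_
    intro s hs
    rw [interior_Ici] at hs
    have h1 : HasDerivAt (fun s => s * cosh s - sinh s) (1 * cosh s + s * sinh s - cosh s) s :=
      ((hasDerivAt_id s).mul (hasDerivAt_cosh s)).sub (hasDerivAt_sinh s)
    rw [h1.deriv]
    have : 0 < s * sinh s := mul_pos hs (sinh_pos_iff.2 hs)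
    linarith
  have := h (mem_Ici.2 le_rfl) (mem_Ici.2 ht.le) ht.le
  simp at this
  linarith

lemma one_add_sq_le_cosh (t : ℝ) (ht : 0 < t) : 1 + t ^ 2 / 2 ≤ cosh t := by
  have h := cosh_two_mul (t / 2)
  have h' := cosh_sq_sub_sinh_sq (t / 2)
  rw [show 2 * (t / 2) = t by ring] at h
  have := self_le_sinh (half_pos ht)
  nlinarith

lemma mul_sq_le_sinh {t : ℝ} (ht : 0 < t) : t * (1 + t) ^ 2 ≤ 9 * sinh t := by
  have h := sinh_two_mul (t / 2)
  rw [show 2 * (t / 2) = t by ring] at h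
  have h1 := self_le_sinh (half_pos ht)
  have h2 := one_add_sq_le_cosh _ (half_pos ht)
  have h3 : t / 2 * (1 + (t / 2) ^ 2 / 2) ≤ sinh (t / 2) * cosh (t / 2) := by gcongr
  nlinarith [mul_nonneg ht.le (sq_nonneg (t - 8))]

lemma cosh_sub_one_div_sinh_nonneg {t : ℝ} (ht : 0 < t) : 0 ≤ (cosh t - 1) / sinh t :=
  div_nonneg (by linarith [one_le_cosh t]) (sinh_pos_iff.2 ht).le

lemma cosh_sub_one_div_sinh_eq {t : ℝ} (ht : 0 < t) :
    (cosh t - 1) / sinh t = sinh t / (cosh t + 1) := by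
  have := cosh_sq_sub_sinh_sq t
  have hc := cosh_pos t
  rw [div_eq_div_iff (sinh_pos_iff.2 ht).ne' (by positivity)]
  linarith

lemma cosh_sub_one_div_sinh_le_one {t : ℝ} (ht : 0 < t) : (cosh t - 1) / sinh t ≤ 1 := by
  rw [div_le_one (sinh_pos_iff.2 ht)]
  have h := cosh_sub_sinh t
  have : exp (-t) ≤ 1 := exp_le_one_iff.2 (by linarith)
  linarith

lemma cosh_sub_one_div_sinh_le {t : ℝ} (ht : 0 < t) : (cosh t - 1) / sinh t ≤ t := by
  have hc := cosh_pos t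
  rw [cosh_sub_one_div_sinh_eq ht, div_le_iff₀ (by positivity)]
  linarith [sinh_le_mul_cosh ht]

lemma coth_sub_inv_nonneg {t : ℝ} (ht : 0 < t) : 0 ≤ cosh t / sinh t - 1 / t := by
  rw [sub_nonneg, div_le_div_iff₀ ht (sinh_pos_iff.2 ht)]
  linarith [sinh_le_mul_cosh ht]

lemma coth_sub_inv_le {t : ℝ} (ht : 0 < t) :
    cosh t / sinh t - 1 / t ≤ (cosh t - 1) / sinh t := by
  have : 1 / sinh t ≤ 1 / t := one_div_le_one_div_of_le ht (self_le_sinh ht)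
  rw [sub_div]
  linarith

lemma inv_sq_sub_inv_sinh_sq_nonneg {t : ℝ} (ht : 0 < t) : 0 ≤ 1 / t ^ 2 - 1 / sinh t ^ 2 := by
  have := self_le_sinh ht
  rw [sub_nonneg]
  gcongr

lemma inv_sq_sub_inv_sinh_sq_le {t : ℝ} (ht : 0 < t) : 1 / t ^ 2 - 1 / sinh t ^ 2 ≤ 1 := by
  have hs : 0 < sinh t := sinh_pos_iff.2 ht
  have h := cosh_sq_sub_sinh_sq t
  have h1 : sinh t ^ 2 ≤ (t * cosh t) ^ 2 := by
    have := sinh_le_mul_cosh ht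
    gcongr
  rw [div_sub_div _ _ (by positivity) (by positivity), div_le_one (by positivity)]
  nlinarith

lemma log_sinh_sub_log_nonneg {t : ℝ} (ht : 0 < t) : 0 ≤ log (sinh t) - log t :=
  sub_nonneg.2 (log_le_log ht (self_le_sinh ht))

lemma log_sinh_sub_log_le {t : ℝ} (ht : 0 < t) : log (sinh t) - log t ≤ t ^ 2 / 2 := by
  have h : sinh t ≤ t * exp (t ^ 2 / 2) :=
    (sinh_le_mul_cosh ht).trans (by gcongr; exact cosh_le_exp_half_sq t)
  have := log_le_log (sinh_pos_iff.2 ht) h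
  rw [log_mul ht.ne' (exp_pos _).ne', log_exp] at this
  linarith

lemma mul_exp_neg_le_one (u : ℝ) : u * exp (-u) ≤ 1 := by
  rw [exp_neg, ← div_eq_mul_inv, div_le_one (exp_pos u)]
  linarith [add_one_le_exp u]

lemma abs_exp_sub_one_le_mul (P : ℝ) : |exp P - 1| ≤ |P| * exp |P| := by
  have h1 := add_one_le_exp P
  have h3 : 1 ≤ exp |P| := one_le_exp (abs_nonneg P)
  have h4 : 1 - P ≤ exp (-P) := by linarith [add_one_le_exp (-P)]
  have h5 : exp (-P) * exp P = 1 := by rw [← exp_add]; simp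
  rw [abs_le]
  constructor
  · nlinarith [neg_abs_le P, abs_nonneg P]
  · have h6 : exp P - 1 ≤ P * exp P := by nlinarith [exp_pos P]
    have h7 : P * exp P ≤ |P| * exp |P| := by
      have := le_abs_self P
      gcongr
    linarith

/-! ### The derivative of the classical kernel -/

lemma exp_neg_log_two_pi_le_one : exp (-(log (2 * π) / 2)) ≤ 1 := by
  have : 0 ≤ log (2 * π) := log_nonneg (by linarith [pi_gt_three])
  exact exp_le_one_iff.2 (by linarith)

lemma exp_logHeat_le {D t : ℝ} (ht : 0 < t) :
    exp (logHeat D t) ≤ 1 / √t * exp (-(D / (2 * t))) := by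
  rw [one_div_sqrt_eq_exp ht, logHeat, sub_eq_add_neg, sub_eq_add_neg, exp_add, exp_add]
  have := exp_neg_log_two_pi_le_one
  have h1 := exp_pos (-(log t / 2))
  gcongr
  nlinarith

lemma one_add_cube_le_exp {v : ℝ} (hv : 0 ≤ v) : (1 + v) ^ 3 ≤ 216 * exp (v / 2) := by
  have h : exp (v / 2) = exp (v / 6) ^ 3 := by rw [← exp_nat_mul]; congr 1; push_cast; ring
  have h1 : 1 + v ≤ 6 * exp (v / 6) := by linarith [add_one_le_exp (v / 6)]
  calc (1 + v) ^ 3 ≤ (6 * exp (v / 6)) ^ 3 := by gcongr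
    _ = 216 * exp (v / 2) := by rw [h]; ring

lemma heat_deriv_bound {D t : ℝ} (hD : 0 ≤ D) (ht : 0 < t) :
    exp (logHeat D t) * |-(1 / (2 * t)) + D / (2 * t ^ 2)| ≤ 216 * (1 / ((t + D) * √(t + D))) := by
  set v := D / t with hv
  have hv0 : 0 ≤ v := by positivity
  have hDv : D = v * t := by rw [hv]; field_simp
  have h1 : |-(1 / (2 * t)) + D / (2 * t ^ 2)| ≤ 1 / t * (1 + v) := by
    have e : -(1 / (2 * t)) + D / (2 * t ^ 2) = 1 / t * ((v - 1) / 2) := by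
      rw [hDv]; field_simp; ring
    rw [e, abs_mul, abs_of_pos (by positivity : 0 < 1 / t)]
    gcongr
    rw [abs_le]
    constructor <;> linarith
  have h2 : √(t + D) ≤ √t * (1 + v) := by
    rw [hDv, show t + v * t = t * (1 + v) by ring, sqrt_mul ht.le]
    gcongr
    rw [sqrt_le_left (by positivity)]
    nlinarith
  have h3 : exp (-(D / (2 * t))) * (1 + v) ^ 3 ≤ 216 := by
    have e : D / (2 * t) = v / 2 := by rw [hv]; field_simp
    rw [e, exp_neg, inv_mul_le_iff₀ (exp_pos _), mul_comm]
    exact one_add_cube_le_exp hv0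
  have hst : 0 < √t := sqrt_pos.2 ht
  calc exp (logHeat D t) * |-(1 / (2 * t)) + D / (2 * t ^ 2)|
      ≤ (1 / √t * exp (-(D / (2 * t)))) * (1 / t * (1 + v)) := by
        gcongr
        exact exp_logHeat_le ht
    _ = (exp (-(D / (2 * t))) * (1 + v) ^ 3) * (1 / ((t * (1 + v)) * (√t * (1 + v)))) := by
        field_simp
    _ ≤ 216 * (1 / ((t * (1 + v)) * (√t * (1 + v)))) := by gcongr
    _ ≤ 216 * (1 / ((t + D) * √(t + D))) := by
        have : t * (1 + v) = t + D := by rw [hDv]; ring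
        rw [this]
        have : 0 < t + D := by positivity
        have := sqrt_pos.2 this
        gcongr

/-! ### Large times -/

lemma mehler_deriv_bound {D p c t : ℝ} (hD : 0 ≤ D) (hp : -1 ≤ p) (hc : c ≤ 1) (ht : 0 < t) :
    exp (logMehler D p c t) *
        |-(cosh t / sinh t / 2) + D / (2 * sinh t ^ 2) - p / (cosh t + 1)| ≤
      9 * exp 2 * (1 / (t * √t)) := by
  have hs : 0 < sinh t := sinh_pos_iff.2 ht
  have hch : 1 ≤ cosh t := one_le_cosh t
  have hch0 : 0 < cosh t := cosh_pos t
  have hts := self_le_sinh ht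
  set r := (cosh t - 1) / sinh t with hr
  have hr0 : 0 ≤ r := cosh_sub_one_div_sinh_nonneg ht
  have hr1 : r ≤ 1 := cosh_sub_one_div_sinh_le_one ht
  set k := cosh t / sinh t with hk
  have hk0 : 0 < k := by positivity
  set u := D / 2 * k with hu
  have hu0 : 0 ≤ u := by positivity
  set w := p * r with hw
  have hw1 : -1 ≤ w := by nlinarith
  have hsq : 0 < √(sinh t) := sqrt_pos.2 hs
  have heu : exp (-u) ≤ 1 := exp_le_one_iff.2 (by linarith)
  have hew : exp (-w) ≤ exp 1 := exp_le_exp.2 (by linarith)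
  have hec : exp c ≤ exp 1 := exp_le_exp.2 hc
  have he1 : 1 ≤ exp 1 := one_le_exp zero_le_one
  have hexp : exp (logMehler D p c t) ≤ 1 / √(sinh t) * exp 1 * (exp (-u) * exp (-w)) := by
    have e : exp (logMehler D p c t) = exp (-(log (2 * π) / 2)) *
        (1 / √(sinh t)) * exp c * (exp (-u) * exp (-w)) := by
      rw [one_div_sqrt_eq_exp hs, ← exp_add, ← exp_add, ← exp_add, ← exp_add, logMehler]
      congr 1
      ring
    rw [e]
    have := exp_neg_log_two_pi_le_one
    gcongr
    exact mul_le_of_le_one_left (by positivity) this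
  have hk1 : k ≤ (1 + t) / t := by
    have := coth_sub_inv_le ht
    rw [add_div, div_self ht.ne']
    linarith
  have hinv : 1 / t ≤ (1 + t) / t := by gcongr; linarith
  have b1 : exp (-u) * exp (-w) * (k / 2) ≤ exp 1 * ((1 + t) / t) := by
    calc exp (-u) * exp (-w) * (k / 2) ≤ 1 * exp 1 * ((1 + t) / t) := by
          gcongr ?_ * ?_ * ?_
          exact (half_le_self hk0.le).trans hk1
      _ = _ := by ring
  have b2 : exp (-u) * exp (-w) * (D / (2 * sinh t ^ 2)) ≤ exp 1 * ((1 + t) / t) := by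
    have e : D / (2 * sinh t ^ 2) = u * (1 / (sinh t * cosh t)) := by
      rw [hu, hk]; field_simp
    have h1 : 1 / (sinh t * cosh t) ≤ 1 / t := by
      gcongr; nlinarith
    calc exp (-u) * exp (-w) * (D / (2 * sinh t ^ 2))
        = exp (-w) * (u * exp (-u)) * (1 / (sinh t * cosh t)) := by rw [e]; ring
      _ ≤ exp 1 * 1 * (1 / t) := by
        gcongr
        exact mul_exp_neg_le_one u
      _ ≤ _ := by rw [mul_one]; gcongr
  have b3 : exp (-u) * exp (-w) * (|p| / (cosh t + 1)) ≤ exp 1 * ((1 + t) / t) := by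
    suffices h : exp (-w) * (|p| / (cosh t + 1)) ≤ exp 1 * (1 / t) by
      calc exp (-u) * exp (-w) * (|p| / (cosh t + 1))
          = exp (-u) * (exp (-w) * (|p| / (cosh t + 1))) := by ring
        _ ≤ 1 * (exp 1 * (1 / t)) := by gcongr
        _ ≤ _ := by rw [one_mul]; gcongr
    rcases le_total 0 p with h0 | h0
    · have e : |p| / (cosh t + 1) = w * (1 / sinh t) := by
        rw [abs_of_nonneg h0, hw, hr, cosh_sub_one_div_sinh_eq ht]
        field_simp
      calc exp (-w) * (|p| / (cosh t + 1)) = (w * exp (-w)) * (1 / sinh t) := by rw [e]; ring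
        _ ≤ exp 1 * (1 / t) := by
          gcongr
          exact (mul_exp_neg_le_one w).trans he1
    · have h1 : |p| ≤ 1 := abs_le.2 ⟨hp, by linarith⟩
      have h2 : t ≤ cosh t + 1 := by nlinarith [one_add_sq_le_cosh t ht, sq_nonneg (t - 1)]
      gcongr
  have hG : |-(k / 2) + D / (2 * sinh t ^ 2) - p / (cosh t + 1)| ≤
      k / 2 + D / (2 * sinh t ^ 2) + |p| / (cosh t + 1) := by
    have h1 := abs_sub (-(k / 2) + D / (2 * sinh t ^ 2)) (p / (cosh t + 1))
    have h2 := abs_add_le (-(k / 2)) (D / (2 * sinh t ^ 2))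
    rw [abs_neg, abs_of_nonneg (by positivity : 0 ≤ k / 2),
      abs_of_nonneg (by positivity : 0 ≤ D / (2 * sinh t ^ 2))] at h2
    rw [abs_div p, abs_of_pos (by positivity : 0 < cosh t + 1)] at h1
    linarith
  have hsqrt : √t * (1 + t) ≤ 3 * √(sinh t) := by
    have h := sqrt_le_sqrt (mul_sq_le_sinh ht)
    rw [sqrt_mul ht.le, sqrt_sq (by positivity), sqrt_mul (by norm_num),
      show (9 : ℝ) = 3 ^ 2 by norm_num, sqrt_sq (by norm_num)] at h
    exact h
  have hst : 0 < √t := sqrt_pos.2 ht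
  have hfin : 1 / √(sinh t) * ((1 + t) / t) ≤ 3 * (1 / (t * √t)) := by
    rw [div_mul_div_comm, mul_one_div, div_le_div_iff₀ (by positivity) (by positivity)]
    nlinarith
  have h22 : exp 2 = exp 1 * exp 1 := by rw [← exp_add]; norm_num
  calc exp (logMehler D p c t) * |-(k / 2) + D / (2 * sinh t ^ 2) - p / (cosh t + 1)|
      ≤ (1 / √(sinh t) * exp 1 * (exp (-u) * exp (-w))) *
        (k / 2 + D / (2 * sinh t ^ 2) + |p| / (cosh t + 1)) := by gcongr
    _ = (1 / √(sinh t) * exp 1) * (exp (-u) * exp (-w) * (k / 2) +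
        exp (-u) * exp (-w) * (D / (2 * sinh t ^ 2)) +
        exp (-u) * exp (-w) * (|p| / (cosh t + 1))) := by ring
    _ ≤ (1 / √(sinh t) * exp 1) * (exp 1 * ((1 + t) / t) + exp 1 * ((1 + t) / t) +
        exp 1 * ((1 + t) / t)) := by gcongr
    _ = 3 * exp 2 * (1 / √(sinh t) * ((1 + t) / t)) := by rw [h22]; ring
    _ ≤ 3 * exp 2 * (3 * (1 / (t * √t))) := by gcongr
    _ = _ := by ring

/-! ### Small times -/

lemma abs_logMehler_sub_logHeat_le {D p c t m : ℝ} (hD : 0 ≤ D) (hD4 : D ≤ 4) (hm : 1 ≤ m)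
    (hp : |p| ≤ 3 * m ^ 2) (ht : 0 < t) (htm : m ^ 2 * t ≤ 1) :
    |logMehler D p c t - logHeat D t| ≤ 6 * (m ^ 2 * t) + |c| := by
  have hm2 : 1 ≤ m ^ 2 := one_le_pow₀ hm
  have ht1 : t ≤ 1 := by nlinarith
  have htm' : t ≤ m ^ 2 * t := by nlinarith
  have hr0 := cosh_sub_one_div_sinh_nonneg ht
  have hr := cosh_sub_one_div_sinh_le ht
  have hk0 := coth_sub_inv_nonneg ht
  have hk := (coth_sub_inv_le ht).trans hr
  have hl0 := log_sinh_sub_log_nonneg ht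
  have hl := log_sinh_sub_log_le ht
  have e : logMehler D p c t - logHeat D t = -((log (sinh t) - log t) / 2)
      - D / 2 * (cosh t / sinh t - 1 / t) - p * ((cosh t - 1) / sinh t) + c := by
    rw [logMehler, logHeat]
    field_simp
    ring
  rw [e]
  have a1 : D / 2 * (cosh t / sinh t - 1 / t) ≤ 2 * t := by
    calc _ ≤ 4 / 2 * t := by gcongr
      _ = _ := by ring
  have a1' : 0 ≤ D / 2 * (cosh t / sinh t - 1 / t) := by positivity
  have a2 : |p * ((cosh t - 1) / sinh t)| ≤ 3 * m ^ 2 * t := by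
    rw [abs_mul, abs_of_nonneg hr0]
    gcongr
  have a3 : (log (sinh t) - log t) / 2 ≤ t := by nlinarith
  have hc1 := neg_abs_le c
  have hc2 := le_abs_self c
  rw [abs_le] at a2 ⊢
  constructor <;> linarith [a2.1, a2.2]

lemma abs_deriv_logMehler_sub_le {D p t m : ℝ} (hD : 0 ≤ D) (hD4 : D ≤ 4) (hm : 1 ≤ m)
    (hp : |p| ≤ 3 * m ^ 2) (ht : 0 < t) :
    |(-(cosh t / sinh t / 2) + D / (2 * sinh t ^ 2) - p / (cosh t + 1)) -
      (-(1 / (2 * t)) + D / (2 * t ^ 2))| ≤ 6 * m ^ 2 := by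
  have hm2 : 1 ≤ m ^ 2 := one_le_pow₀ hm
  have hr := cosh_sub_one_div_sinh_le_one ht
  have hk0 := coth_sub_inv_nonneg ht
  have hk := (coth_sub_inv_le ht).trans hr
  have hq0 := inv_sq_sub_inv_sinh_sq_nonneg ht
  have hq := inv_sq_sub_inv_sinh_sq_le ht
  have hch : 1 ≤ cosh t := one_le_cosh t
  have hs : 0 < sinh t := sinh_pos_iff.2 ht
  have e : (-(cosh t / sinh t / 2) + D / (2 * sinh t ^ 2) - p / (cosh t + 1)) -
      (-(1 / (2 * t)) + D / (2 * t ^ 2)) = -((cosh t / sinh t - 1 / t) / 2) -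
      D / 2 * (1 / t ^ 2 - 1 / sinh t ^ 2) - p / (cosh t + 1) := by
    field_simp
    ring
  rw [e]
  have a1 : D / 2 * (1 / t ^ 2 - 1 / sinh t ^ 2) ≤ 2 := by
    calc _ ≤ 4 / 2 * (1 : ℝ) := by gcongr
      _ = _ := by norm_num
  have a1' : 0 ≤ D / 2 * (1 / t ^ 2 - 1 / sinh t ^ 2) := by positivity
  have a2 : |p / (cosh t + 1)| ≤ 3 * m ^ 2 := by
    rw [abs_div, abs_of_pos (by positivity : 0 < cosh t + 1)]
    exact (div_le_self (abs_nonneg p) (by linarith)).trans hp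
  rw [abs_le] at a2 ⊢
  constructor <;> linarith [a2.1, a2.2]

/-- The dominating function for the difference of the two kernels. -/
noncomputable def majorant (m d t : ℝ) : ℝ :=
  m ^ 2 / (√t * (1 + m ^ 2 * t)) + m * d * (1 / ((t + d ^ 2) * √(t + d ^ 2)))

lemma small_time_bound {p c t m d : ℝ} (hd : 0 < d) (hd2 : d ≤ 2) (hm : 1 ≤ m)
    (hp : |p| ≤ 3 * m ^ 2) (hc : |c| ≤ 2 * m * d) (hc1 : |c| ≤ 1) (ht : 0 < t)
    (htm : m ^ 2 * t ≤ 1) :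
    |exp (logMehler (d ^ 2) p c t) *
        (-(cosh t / sinh t / 2) + d ^ 2 / (2 * sinh t ^ 2) - p / (cosh t + 1)) -
      exp (logHeat (d ^ 2) t) * (-(1 / (2 * t)) + d ^ 2 / (2 * t ^ 2))| ≤
      3000 * exp 7 * majorant m d t := by
  have hD : 0 ≤ d ^ 2 := by positivity
  have hD4 : d ^ 2 ≤ 4 := by nlinarith
  have hP := abs_logMehler_sub_logHeat_le (c := c) hD hD4 hm hp ht htm
  have hGH := abs_deriv_logMehler_sub_le hD hD4 hm hp ht
  have hH := heat_deriv_bound hD ht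
  set G := -(cosh t / sinh t / 2) + d ^ 2 / (2 * sinh t ^ 2) - p / (cosh t + 1)
  set H := -(1 / (2 * t)) + d ^ 2 / (2 * t ^ 2)
  set P := logMehler (d ^ 2) p c t - logHeat (d ^ 2) t
  have hst : 0 < √t := sqrt_pos.2 ht
  have hexp : exp (logMehler (d ^ 2) p c t) = exp (logHeat (d ^ 2) t) * exp P := by
    rw [← exp_add]; congr 1; ring
  have hh : exp (logHeat (d ^ 2) t) ≤ 1 / √t := by
    refine (exp_logHeat_le ht).trans (mul_le_of_le_one_right (by positivity) ?_)
    exact exp_le_one_iff.2 (neg_nonpos.2 (by positivity))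
  have hP7 : exp |P| ≤ exp 7 := exp_le_exp.2 (by linarith)
  have hPP : exp P ≤ exp 7 := (exp_le_exp.2 (le_abs_self P)).trans hP7
  have hP1 : |exp P - 1| ≤ (6 * (m ^ 2 * t) + 2 * m * d) * exp 7 := by
    refine (abs_exp_sub_one_le_mul P).trans ?_
    gcongr
    linarith
  set R := 1 / ((t + d ^ 2) * √(t + d ^ 2)) with hR
  have hR0 : 0 ≤ R := by positivity
  have hRt : t * R ≤ 1 / √t := by
    rw [hR, mul_one_div, div_le_div_iff₀ (by positivity) hst]
    have : √t ≤ √(t + d ^ 2) := sqrt_le_sqrt (by linarith)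
    have : t ≤ t + d ^ 2 := by linarith
    rw [one_mul]
    gcongr
  have hM : m ^ 2 * (1 / √t) ≤ 2 * (m ^ 2 / (√t * (1 + m ^ 2 * t))) := by
    rw [mul_one_div, ← mul_div_assoc, div_le_div_iff₀ hst (by positivity)]
    have : 0 < m ^ 2 * √t := by positivity
    nlinarith
  have t1 : |exp (logHeat (d ^ 2) t) * exp P * (G - H)| ≤ 6 * exp 7 * (m ^ 2 * (1 / √t)) := by
    rw [abs_mul, abs_of_pos (by positivity)]
    calc _ ≤ 1 / √t * exp 7 * (6 * m ^ 2) := by gcongr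
      _ = _ := by ring
  have t2 : |exp (logHeat (d ^ 2) t) * H * (exp P - 1)| ≤
      exp 7 * (1296 * (m ^ 2 * (1 / √t)) + 432 * (m * d * R)) := by
    rw [abs_mul, abs_mul, abs_of_pos (exp_pos _)]
    calc _ ≤ 216 * R * ((6 * (m ^ 2 * t) + 2 * m * d) * exp 7) := by gcongr
      _ = exp 7 * (1296 * (m ^ 2 * (t * R)) + 432 * (m * d * R)) := by ring
      _ ≤ _ := by gcongr
  have e : exp (logMehler (d ^ 2) p c t) * G - exp (logHeat (d ^ 2) t) * H =
      exp (logHeat (d ^ 2) t) * exp P * (G - H) + exp (logHeat (d ^ 2) t) * H * (exp P - 1) := by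
    rw [hexp]; ring
  rw [e, majorant, ← hR]
  calc _ ≤ 6 * exp 7 * (m ^ 2 * (1 / √t)) +
        exp 7 * (1296 * (m ^ 2 * (1 / √t)) + 432 * (m * d * R)) :=
        (abs_add_le _ _).trans (add_le_add t1 t2)
    _ = exp 7 * (1302 * (m ^ 2 * (1 / √t)) + 432 * (m * d * R)) := by ring
    _ ≤ exp 7 * (1302 * (2 * (m ^ 2 / (√t * (1 + m ^ 2 * t)))) + 3000 * (m * d * R)) := by
        have : 0 ≤ m * d * R := by positivity
        gcongr
        norm_num
    _ ≤ exp 7 * (3000 * (m ^ 2 / (√t * (1 + m ^ 2 * t))) + 3000 * (m * d * R)) := by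
        have : 0 ≤ m ^ 2 / (√t * (1 + m ^ 2 * t)) := by positivity
        refine mul_le_mul_of_nonneg_left ?_ (exp_pos 7).le
        linarith
    _ = _ := by ring

lemma large_time_bound {p c t m d : ℝ} (hd : 0 < d) (hm : 1 ≤ m)
    (hp : -1 ≤ p) (hc : c ≤ 1) (ht : 0 < t) (htm : 1 ≤ m ^ 2 * t) :
    |exp (logMehler (d ^ 2) p c t) *
        (-(cosh t / sinh t / 2) + d ^ 2 / (2 * sinh t ^ 2) - p / (cosh t + 1)) -
      exp (logHeat (d ^ 2) t) * (-(1 / (2 * t)) + d ^ 2 / (2 * t ^ 2))| ≤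
      3000 * exp 7 * majorant m d t := by
  have hD : 0 ≤ d ^ 2 := by positivity
  have hst : 0 < √t := sqrt_pos.2 ht
  have hH := heat_deriv_bound hD ht
  have hG := mehler_deriv_bound hD hp hc ht
  have hR : 1 / ((t + d ^ 2) * √(t + d ^ 2)) ≤ 1 / (t * √t) := by
    have : √t ≤ √(t + d ^ 2) := sqrt_le_sqrt (by linarith)
    gcongr
    linarith
  have hM : 1 / (t * √t) ≤ 2 * majorant m d t := by
    have h1 : 1 / (t * √t) ≤ 2 * (m ^ 2 / (√t * (1 + m ^ 2 * t))) := by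
      rw [← mul_div_assoc, div_le_div_iff₀ (by positivity) (by positivity)]
      nlinarith
    have : 0 ≤ m * d * (1 / ((t + d ^ 2) * √(t + d ^ 2))) := by positivity
    rw [majorant]
    linarith
  have hM0 : 0 ≤ majorant m d t := by rw [majorant]; positivity
  have h27 : exp 2 ≤ exp 7 := exp_le_exp.2 (by norm_num)
  have h7 : 1 ≤ exp 7 := one_le_exp (by norm_num)
  refine (abs_sub _ _).trans ?_
  rw [abs_mul, abs_mul, abs_of_pos (exp_pos _), abs_of_pos (exp_pos _)]
  calc _ ≤ 9 * exp 2 * (1 / (t * √t)) + 216 * (1 / (t * √t)) := by linarith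
    _ = (9 * exp 2 + 216) * (1 / (t * √t)) := by ring
    _ ≤ (1500 * exp 7) * (2 * majorant m d t) := by
        gcongr
        linarith
    _ = _ := by ring

/-! ### Integrals of the dominating functions -/

lemma integrableOn_and_integral_inv_rpow {d : ℝ} (hd : 0 < d) :
    IntegrableOn (fun t => 1 / ((t + d ^ 2) * √(t + d ^ 2))) (Ioi 0) ∧
      ∫ t in Ioi (0 : ℝ), 1 / ((t + d ^ 2) * √(t + d ^ 2)) = 2 / d := by
  have hderiv : ∀ t ∈ Ioi (0 : ℝ), HasDerivAt (fun t => -2 / √(t + d ^ 2))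
      (1 / ((t + d ^ 2) * √(t + d ^ 2))) t := by
    intro t ht
    have ht : 0 < t := ht
    have h0 : 0 < t + d ^ 2 := by positivity
    have hs := sqrt_pos.2 h0
    refine ((((hasDerivAt_id t).add_const (d ^ 2)).sqrt h0.ne').inv hs.ne'
      |>.const_mul (-2)).congr_deriv ?_
    simp only [id]
    rw [sq_sqrt h0.le]
    field_simp
  have hcont : ContinuousWithinAt (fun t => -2 / √(t + d ^ 2)) (Ici 0) 0 := by
    refine ContinuousAt.continuousWithinAt ?_
    refine ContinuousAt.div (by fun_prop) (by fun_prop) ?_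
    rw [zero_add, sqrt_sq hd.le]
    exact hd.ne'
  have hlim : Filter.Tendsto (fun t => -2 / √(t + d ^ 2)) Filter.atTop (nhds 0) :=
    Filter.Tendsto.const_div_atTop
      (tendsto_sqrt_atTop.comp (Filter.tendsto_atTop_add_const_right _ _ Filter.tendsto_id)) _
  have hnn : ∀ t ∈ Ioi (0 : ℝ), 0 ≤ 1 / ((t + d ^ 2) * √(t + d ^ 2)) := by
    intro t ht
    have ht : 0 < t := ht
    positivity
  refine ⟨integrableOn_Ioi_deriv_of_nonneg hcont hderiv hnn hlim, ?_⟩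
  rw [integral_Ioi_of_hasDerivAt_of_nonneg hcont hderiv hnn hlim, zero_add, sqrt_sq hd.le]
  ring

lemma integrableOn_and_integral_arctan_deriv {m : ℝ} (hm : 0 < m) :
    IntegrableOn (fun t => m ^ 2 / (√t * (1 + m ^ 2 * t))) (Ioi 0) ∧
      ∫ t in Ioi (0 : ℝ), m ^ 2 / (√t * (1 + m ^ 2 * t)) = π * m := by
  have hderiv : ∀ t ∈ Ioi (0 : ℝ), HasDerivAt (fun t => 2 * m * arctan (m * √t))
      (m ^ 2 / (√t * (1 + m ^ 2 * t))) t := by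
    intro t ht
    have ht : 0 < t := ht
    have hs := sqrt_pos.2 ht
    refine ((((hasDerivAt_id t).sqrt ht.ne').const_mul m).arctan.const_mul
      (2 * m)).congr_deriv ?_
    simp only [id]
    rw [mul_pow, sq_sqrt ht.le]
    field_simp
  have hcont : ContinuousWithinAt (fun t => 2 * m * arctan (m * √t)) (Ici 0) 0 := by
    have : Continuous (fun t => 2 * m * arctan (m * √t)) := by fun_prop
    exact this.continuousWithinAt
  have hlim : Filter.Tendsto (fun t => 2 * m * arctan (m * √t)) Filter.atTop
      (nhds (2 * m * (π / 2))) :=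
    ((tendsto_nhds_of_tendsto_nhdsWithin tendsto_arctan_atTop).comp
      (tendsto_sqrt_atTop.const_mul_atTop hm)).const_mul _
  have hnn : ∀ t ∈ Ioi (0 : ℝ), 0 ≤ m ^ 2 / (√t * (1 + m ^ 2 * t)) := by
    intro t ht
    have ht : 0 < t := ht
    positivity
  refine ⟨integrableOn_Ioi_deriv_of_nonneg hcont hderiv hnn hlim, ?_⟩
  rw [integral_Ioi_of_hasDerivAt_of_nonneg hcont hderiv hnn hlim]
  simp
  ring

lemma integrableOn_majorant {m d : ℝ} (hm : 0 < m) (hd : 0 < d) :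
    IntegrableOn (majorant m d) (Ioi 0) :=
  (integrableOn_and_integral_arctan_deriv hm).1.add
    ((integrableOn_and_integral_inv_rpow hd).1.const_mul (m * d))

lemma integral_majorant_le {m d : ℝ} (hm : 0 < m) (hd : 0 < d) :
    ∫ t in Ioi (0 : ℝ), majorant m d t ≤ 6 * m := by
  have h1 := integrableOn_and_integral_arctan_deriv hm
  have h2 := integrableOn_and_integral_inv_rpow hd
  simp only [majorant]
  rw [integral_add h1.1 (h2.1.const_mul (m * d)), integral_const_mul, h1.2, h2.2]
  have : m * d * (2 / d) = 2 * m := by field_simp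
  rw [this]
  nlinarith [pi_lt_four]

/-! ### The local region -/

lemma deriv_Wheat {t : ℝ} (ht : 0 < t) (x y : ℝ) :
    deriv (fun s => Wheat s x y) t = exp (logHeat (|x - y| ^ 2) t) *
      (-(1 / (2 * t)) + |x - y| ^ 2 / (2 * t ^ 2)) := by
  rw [sq_abs]
  refine ((hasDerivAt_logHeat _ ht).exp.congr_of_eventuallyEq ?_).deriv
  filter_upwards [Ioi_mem_nhds ht] with s hs using Wheat_eq_exp hs x y

lemma exp_mul_deriv_WO {t : ℝ} (ht : 0 < t) (x y : ℝ) :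
    exp (-y ^ 2) * deriv (fun s => exp (-s / 2) * WO s x y) t =
      exp (logMehler (|x - y| ^ 2) (x * y) ((x ^ 2 - y ^ 2) / 2) t) *
      (-(cosh t / sinh t / 2) + |x - y| ^ 2 / (2 * sinh t ^ 2) - x * y / (cosh t + 1)) := by
  rw [sq_abs]
  have h := ((hasDerivAt_logMehler ((x - y) ^ 2) (x * y) ((x ^ 2 - y ^ 2) / 2) ht).exp.const_mul
    (exp (-y ^ 2))⁻¹).congr_of_eventuallyEq (f₁ := fun s => exp (-s / 2) * WO s x y) ?_
  · rw [h.deriv, mul_inv_cancel_left₀ (exp_pos _).ne']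
  · filter_upwards [Ioi_mem_nhds ht] with s hs
    rw [← exp_mul_WO_eq_exp hs, inv_mul_cancel_left₀ (exp_pos _).ne']

lemma deriv_difference_bound {x y t : ℝ} (hxy : (x, y) ∈ Nreg 2) (hne : x ≠ y) (ht : 0 < t) :
    |exp (-y ^ 2) * deriv (fun s => exp (-s / 2) * WO s x y) t -
      deriv (fun s => Wheat s x y) t| ≤ 3000 * exp 7 * majorant (max 1 |x|) |x - y| t := by
  have hd : 0 < |x - y| := abs_pos.2 (sub_ne_zero.2 hne)
  have hx0 := abs_nonneg x
  have hy0 := abs_nonneg y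
  have hN : |x - y| * (1 + |x| + |y|) ≤ 2 := by
    have h : |x - y| ≤ 2 / (1 + |x| + |y|) := hxy
    rwa [le_div_iff₀ (by positivity)] at h
  have hd2 : |x - y| ≤ 2 := by nlinarith
  have hm : 1 ≤ max 1 |x| := le_max_left _ _
  have hxm : |x| ≤ max 1 |x| := le_max_right _ _
  have hy : |y| ≤ 3 * max 1 |x| := by
    have := abs_sub_abs_le_abs_sub y x
    rw [abs_sub_comm] at this
    linarith
  have hp : |x * y| ≤ 3 * max 1 |x| ^ 2 := by
    rw [abs_mul]
    calc |x| * |y| ≤ max 1 |x| * (3 * max 1 |x|) := by gcongr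
      _ = _ := by ring
  have hp1 : -1 ≤ x * y := by
    have h1 : (x - y) ^ 2 ≤ 4 := by rw [← sq_abs]; nlinarith
    nlinarith [sq_nonneg (x + y)]
  have hc : |(x ^ 2 - y ^ 2) / 2| ≤ |x - y| * (|x| + |y|) / 2 := by
    rw [abs_div, abs_two, show x ^ 2 - y ^ 2 = (x - y) * (x + y) by ring, abs_mul]
    gcongr
    exact abs_add_le x y
  have hc1 : |(x ^ 2 - y ^ 2) / 2| ≤ 1 := by nlinarith
  have hc2 : |(x ^ 2 - y ^ 2) / 2| ≤ 2 * max 1 |x| * |x - y| := by nlinarith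
  rw [exp_mul_deriv_WO ht, deriv_Wheat ht]
  rcases le_total (max 1 |x| ^ 2 * t) 1 with h | h
  · exact small_time_bound hd hd2 hm hp hc2 hc1 ht h
  · exact large_time_bound hd hm hp1 ((le_abs_self _).trans hc1) ht h

lemma integrableOn_deriv_Wheat {x y : ℝ} (hne : x ≠ y) :
    IntegrableOn (deriv (fun s => Wheat s x y)) (Ioi 0) := by
  have hd : 0 < |x - y| := abs_pos.2 (sub_ne_zero.2 hne)
  refine ((integrableOn_and_integral_inv_rpow hd).1.const_mul 216).mono'
    (measurable_deriv _).aestronglyMeasurable ?_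
  filter_upwards [ae_restrict_mem measurableSet_Ioi] with t ht
  rw [deriv_Wheat ht, norm_eq_abs, abs_mul, abs_of_pos (exp_pos _)]
  exact heat_deriv_bound (by positivity) ht

lemma integrableOn_deriv_difference {x y : ℝ} (hxy : (x, y) ∈ Nreg 2) (hne : x ≠ y) :
    IntegrableOn (fun t => exp (-y ^ 2) * deriv (fun s => exp (-s / 2) * WO s x y) t -
      deriv (fun s => Wheat s x y) t) (Ioi 0) := by
  have hd : 0 < |x - y| := abs_pos.2 (sub_ne_zero.2 hne)
  refine ((integrableOn_majorant (lt_max_of_lt_left (c := |x|) one_pos) hd).const_mul (3000 * exp 7)).mono'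
    (((measurable_deriv _).const_mul _).sub (measurable_deriv _)).aestronglyMeasurable ?_
  filter_upwards [ae_restrict_mem measurableSet_Ioi] with t ht
  exact deriv_difference_bound hxy hne ht

lemma integrableOn_deriv_WO {x y : ℝ} (hxy : (x, y) ∈ Nreg 2) (hne : x ≠ y) :
    IntegrableOn (deriv (fun s => exp (-s / 2) * WO s x y)) (Ioi 0) := by
  refine (((integrableOn_deriv_difference hxy hne).add
    (integrableOn_deriv_Wheat hne)).const_mul (exp (-y ^ 2))⁻¹).congr ?_
  refine Filter.Eventually.of_forall fun t => ?_
  simp only [Pi.add_apply, sub_add_cancel]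
  exact inv_mul_cancel_left₀ (exp_pos _).ne' _

lemma integrableOn_mul_ofReal_neg {φ : ℝ → ℂ} {A : ℝ} (hφ : Measurable φ)
    (hA : ∀ᵐ t ∂(volume.restrict (Ioi (0 : ℝ))), ‖φ t‖ ≤ A) {f : ℝ → ℝ}
    (hf : IntegrableOn f (Ioi 0)) :
    IntegrableOn (fun t => φ t * ((-(f t) : ℝ) : ℂ)) (Ioi 0) :=
  Integrable.bdd_mul (c := A) (hf.neg.ofReal) hφ.aestronglyMeasurable hA

end OUComparison

theorem ou_heat_kernel_local_comparison :
    ∃ C > (0:ℝ), ∀ (φ : ℝ → ℂ) (A : ℝ), Measurable φ → 0 < A →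
      (∀ᵐ t ∂(volume.restrict (Set.Ioi (0:ℝ))), ‖φ t‖ ≤ A) →
      ∀ x y : ℝ, (x, y) ∈ Nreg 2 → x ≠ y →
        IntegrableOn
          (fun t => φ t * ((-(deriv (fun s => Real.exp (-s/2) * WO s x y) t) : ℝ) : ℂ))
          (Set.Ioi (0:ℝ)) ∧
        IntegrableOn
          (fun t => φ t * ((-(deriv (fun s => Wheat s x y) t) : ℝ) : ℂ))
          (Set.Ioi (0:ℝ)) ∧
        ‖(Real.exp (-y^2) : ℂ) * BO φ x y - Kheat φ x y‖ ≤ C * A * max 1 |x| := by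
  refine ⟨18000 * Real.exp 7, by positivity, fun φ A hφ hA0 hA x y hxy hne => ?_⟩
  have hd : 0 < |x - y| := abs_pos.2 (sub_ne_zero.2 hne)
  have hm : 0 < max 1 |x| := lt_max_of_lt_left one_pos
  have hB := OUComparison.integrableOn_mul_ofReal_neg hφ hA
    (OUComparison.integrableOn_deriv_WO hxy hne)
  have hK := OUComparison.integrableOn_mul_ofReal_neg hφ hA
    (OUComparison.integrableOn_deriv_Wheat hne)
  refine ⟨hB, hK, ?_⟩
  rw [BO, Kheat, ← integral_const_mul, ← integral_sub (hB.const_mul _) hK]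
  have hmaj := (OUComparison.integrableOn_majorant hm hd).const_mul (A * (3000 * Real.exp 7))
  refine (norm_integral_le_of_norm_le hmaj ?_).trans ?_
  · filter_upwards [hA, ae_restrict_mem measurableSet_Ioi] with t hφt ht
    have hb := OUComparison.deriv_difference_bound hxy hne ht
    set g := deriv (fun s => Real.exp (-s / 2) * WO s x y) t
    set h := deriv (fun s => Wheat s x y) t
    have e : ((Real.exp (-y ^ 2) : ℝ) : ℂ) * (φ t * ((-g : ℝ) : ℂ)) - φ t * ((-h : ℝ) : ℂ) =
        φ t * ((-(Real.exp (-y ^ 2) * g - h) : ℝ) : ℂ) := by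
      push_cast
      ring
    rw [e, norm_mul, Complex.norm_real, norm_neg, Real.norm_eq_abs, mul_assoc A]
    gcongr
  · rw [integral_const_mul]
    calc _ ≤ A * (3000 * Real.exp 7) * (6 * max 1 |x|) := by
          gcongr
          exact OUComparison.integral_majorant_le hm hd
      _ = _ := by ring
end

section
/- There is a constant C > 0 such that: (i) for every x ∈ ℝ, max{1, |x|} · λ({ y ∈ ℝ : (x,y) ∈ N₂ }) ≤ C, where λ is Lebesgue measure; and (ii) for every y ∈ ℝ, ∫_{{ x ∈ ℝ : (x,y) ∈ N₂ }} max{1, |x|} dx ≤ C. -/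
open MeasureTheory Set

theorem Nreg_swap_mem {s x y : ℝ} : (y, x) ∈ Nreg s ↔ (x, y) ∈ Nreg s := by
  simp only [Nreg, mem_ofPred_eq, abs_sub_comm y x, add_right_comm 1 |y| |x|]

theorem Nreg_section_subset {s : ℝ} (hs : 0 ≤ s) (x : ℝ) :
    {y : ℝ | (x, y) ∈ Nreg s} ⊆ Metric.closedBall x (s / (1 + |x|)) := by
  intro y (hy : |x - y| ≤ s / (1 + |x| + |y|))
  rw [Metric.mem_closedBall', Real.dist_eq]
  exact hy.trans (div_le_div_of_nonneg_left hs (by positivity)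
    (le_add_of_nonneg_right (abs_nonneg y)))

theorem volume_Nreg_section_lt_top {s : ℝ} (hs : 0 ≤ s) (x : ℝ) :
    volume {y : ℝ | (x, y) ∈ Nreg s} < ⊤ :=
  (measure_mono (Nreg_section_subset hs x)).trans_lt measure_closedBall_lt_top

theorem volume_real_Nreg_section_le {s : ℝ} (hs : 0 ≤ s) (x : ℝ) :
    volume.real {y : ℝ | (x, y) ∈ Nreg s} ≤ 2 * (s / (1 + |x|)) := by
  have hr : 0 ≤ s / (1 + |x|) := by positivity
  exact (measureReal_mono (Nreg_section_subset hs x) measure_closedBall_lt_top.ne).trans_eq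
    (Real.volume_real_closedBall hr)

theorem max_one_abs_le_of_mem_Nreg {s x y : ℝ} (hs : 0 ≤ s) (h : (x, y) ∈ Nreg s) :
    max 1 |x| ≤ (1 + s) * (1 + |y|) := by
  have hd : |x - y| ≤ s := by
    refine (show |x - y| ≤ s / (1 + |x| + |y|) from h).trans (div_le_self hs ?_)
    linarith [abs_nonneg x, abs_nonneg y]
  have hx : |x| ≤ |y| + s := by linarith [abs_sub_abs_le_abs_sub x y]
  have hsy : 0 ≤ s * |y| := by positivity
  exact max_le (by linarith [abs_nonneg y]) (by linarith)

theorem local_region_section_estimates :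
    ∃ C > (0:ℝ),
      (∀ x : ℝ, max 1 |x| * (volume {y : ℝ | (x, y) ∈ Nreg 2}).toReal ≤ C) ∧
      (∀ y : ℝ, (∫ x in {x : ℝ | (x, y) ∈ Nreg 2}, max 1 |x|) ≤ C) := by
  refine ⟨12, by norm_num, fun x => ?_, fun y => ?_⟩
  · calc max 1 |x| * volume.real {y : ℝ | (x, y) ∈ Nreg 2}
        ≤ (1 + |x|) * (2 * (2 / (1 + |x|))) := by
          gcongr
          · exact max_le (by linarith [abs_nonneg x]) (by linarith)
          · exact volume_real_Nreg_section_le zero_le_two x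
      _ = 4 := by field_simp; norm_num
      _ ≤ 12 := by norm_num
  · have hswap : {x : ℝ | (x, y) ∈ Nreg 2} = {x : ℝ | (y, x) ∈ Nreg 2} :=
      Set.ext fun x => Nreg_swap_mem.symm
    rw [hswap]
    calc ∫ x in {x : ℝ | (y, x) ∈ Nreg 2}, max 1 |x|
        ≤ ((1 + 2) * (1 + |y|)) * volume.real {x : ℝ | (y, x) ∈ Nreg 2} := by
          refine (Real.le_norm_self _).trans (norm_setIntegral_le_of_norm_le_const
            (volume_Nreg_section_lt_top zero_le_two y) fun x hx => ?_)
          rw [Real.norm_of_nonneg (by positivity)]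
          exact max_one_abs_le_of_mem_Nreg zero_le_two (Nreg_swap_mem.mp hx)
      _ ≤ ((1 + 2) * (1 + |y|)) * (2 * (2 / (1 + |y|))) := by
          gcongr
          exact volume_real_Nreg_section_le zero_le_two y
      _ = 12 := by field_simp; norm_num
end
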